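/- arXiv:2406.19795 — 5 statements merged into one kernel-verified Lean document; each statement's English description precedes it below -/
import Mathlib

section
/- Let C : f = 0 be a reduced plane curve of degree d ≥ 3 in P²(ℂ), not the union of d lines through one point, and let r = mdr(f). Then C is a minimal plus-one generated (MPOG) curve if and only if τ(C) = (d−1)² − r(d−r−1) − 2. -/
open MvPolynomial

noncomputable section

/-- `S = ℂ[x,y,z]`, with `x = X 0`, `y = X 1`, `z = X 2`. -/
abbrev S3 := MvPolynomial (Fin 3) ℂ

/-- The graded `S`-module `D_0(f)` of Jacobian syzygies of `f`. -/
def jacSyz (f : S3) : Submodule S3 (Fin 3 → S3) where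
  carrier := {v | v 0 * pderiv 0 f + v 1 * pderiv 1 f + v 2 * pderiv 2 f = 0}
  add_mem' := by
    intro a b ha hb
    simp only [Set.mem_setOf_eq, Pi.add_apply] at *
    linear_combination ha + hb
  zero_mem' := by simp
  smul_mem' := by
    intro c v hv
    simp only [Set.mem_setOf_eq, Pi.smul_apply, smul_eq_mul] at *
    linear_combination c * hv

/-- `v` is a minimal system of `m` homogeneous generators of `D_0(f)`, the generator
`v j` being a syzygy of degree `dd j`, and `dd` nondecreasing: this says that
`C : f = 0` is an `m`-syzygy curve with exponents `dd`. -/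
structure IsMinGenSyz (f : S3) (m : ℕ) (dd : Fin m → ℕ) (v : Fin m → (Fin 3 → S3)) : Prop where
  mem : ∀ j, v j ∈ jacSyz f
  hom : ∀ j i, ((v j) i).IsHomogeneous (dd j)
  ne_zero : ∀ j, v j ≠ 0
  span_eq : Submodule.span S3 (Set.range v) = jacSyz f
  minimal : ∀ j, v j ∉ Submodule.span S3 (v '' {j' | j' ≠ j})
  mono : Monotone dd

/-- `C : f = 0` is free with exponents `(d1, d2)`. -/
def IsFreeWith (f : S3) (d1 d2 : ℕ) : Prop := ∃ v, IsMinGenSyz f 2 ![d1, d2] v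

/-- `C : f = 0` is a free curve (a 2-syzygy curve). -/
def IsFreeCurve (f : S3) : Prop := ∃ d1 d2, IsFreeWith f d1 d2

/-- `C : f = 0` of degree `d` is nearly free with exponents `(d1, d2)`:
a 3-syzygy curve with exponents `(d1, d2, d2)` and `d1 + d2 = d`. -/
def IsNearlyFreeWith (f : S3) (d d1 d2 : ℕ) : Prop :=
  d1 + d2 = d ∧ ∃ v, IsMinGenSyz f 3 ![d1, d2, d2] v

/-- `C : f = 0` of degree `d` is a nearly free curve. -/
def IsNearlyFree (f : S3) (d : ℕ) : Prop := ∃ d1 d2, IsNearlyFreeWith f d d1 d2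

/-- `C : f = 0` of degree `d` is plus-one generated with exponents `(d1, d2, d3)`:
a 3-syzygy curve with `d1 + d2 = d`. -/
def IsPOGWith (f : S3) (d d1 d2 d3 : ℕ) : Prop :=
  d1 + d2 = d ∧ ∃ v, IsMinGenSyz f 3 ![d1, d2, d3] v

/-- `C : f = 0` of degree `d` is a plus-one generated curve. -/
def IsPOG (f : S3) (d : ℕ) : Prop := ∃ d1 d2 d3, IsPOGWith f d d1 d2 d3

/-- `C : f = 0` of degree `d` is minimal plus-one generated (MPOG),
with exponents `(d1, d2, d2 + 1)`. -/
def IsMPOGWith (f : S3) (d d1 d2 : ℕ) : Prop := IsPOGWith f d d1 d2 (d2 + 1)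

/-- `C : f = 0` of degree `d` is an MPOG-curve. -/
def IsMPOG (f : S3) (d : ℕ) : Prop := ∃ d1 d2, IsMPOGWith f d d1 d2

/-- `r = mdr(f)`: the minimal degree of a nonzero (homogeneous) Jacobian relation for `f`. -/
def IsMDR (f : S3) (r : ℕ) : Prop :=
  (∃ v ∈ jacSyz f, v ≠ 0 ∧ ∀ i, (v i).IsHomogeneous r) ∧
  ∀ m, m < r → ∀ v ∈ jacSyz f, (∀ i, (v i).IsHomogeneous m) → v = 0

/-- The Jacobian ideal `J_f` of `f`. -/
def jacobianIdeal (f : S3) : Ideal S3 := Ideal.span {pderiv 0 f, pderiv 1 f, pderiv 2 f}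

/-- The dimension of the degree `k` graded piece of the Milnor algebra `M(f) = S/J_f`. -/
def milnorDim (f : S3) (k : ℕ) : ℕ :=
  Module.finrank ℂ
    (↥(homogeneousSubmodule (Fin 3) ℂ k) ⧸
      (Submodule.comap (homogeneousSubmodule (Fin 3) ℂ k).subtype
        (Submodule.restrictScalars ℂ (jacobianIdeal f))))

/-- `τ` is the total Tjurina number of the reduced curve `C : f = 0`, i.e. the degree of the
Jacobian ideal `J_f`: for all large `k` one has `dim M(f)_k = τ`. -/
def IsTjurina (f : S3) (τ : ℕ) : Prop := ∀ᶠ k in Filter.atTop, milnorDim f k = τ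

/-- `C : f = 0` is a maximal Tjurina curve of type `(d, r)`. -/
def IsMaxTjurina (f : S3) (d r : ℕ) : Prop :=
  IsMDR f r ∧ d ≤ 2 * r ∧
  ∃ τ : ℕ, IsTjurina f τ ∧
    (τ : ℤ) = ((d : ℤ) - 1) ^ 2 - r * ((d : ℤ) - r - 1) - (Nat.choose (2 * r + 2 - d) 2 : ℤ)

/-- `f` is a product of `d` linear forms all vanishing at a common point, i.e.
`C : f = 0` is the union of `d` lines passing through one point. -/
def IsUnionOfConcurrentLines (f : S3) (d : ℕ) : Prop :=
  ∃ (c : ℂ) (L : Fin d → Fin 3 → ℂ) (v : Fin 3 → ℂ), v ≠ 0 ∧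
    f = C c * ∏ j, (∑ i, C (L j i) * X i) ∧ ∀ j, (∑ i, L j i * v i) = 0

/-- The ideal `I_θ` generated by the 2×2 minors of the matrix with rows `(x,y,z)` and
`(a,b,c)`, defining the eigenscheme `Γ_θ` of the derivation `θ = a ∂_x + b ∂_y + c ∂_z`. -/
def eigenIdeal (a b c : S3) : Ideal S3 :=
  Ideal.span {X 1 * c - X 2 * b, X 2 * a - X 0 * c, X 0 * b - X 1 * a}

/-- The projective plane `ℙ²(ℂ)`. -/
abbrev Pt := Projectivization ℂ (Fin 3 → ℂ)

/-- The eigenscheme `Γ_θ` of `θ = a ∂_x + b ∂_y + c ∂_z` is 0-dimensional: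
its set of points in `ℙ²` is finite. -/
def EigenSchemeFinite (a b c : S3) : Prop :=
  {p : Pt | eval p.rep (X 1 * c - X 2 * b) = 0 ∧ eval p.rep (X 2 * a - X 0 * c) = 0 ∧
      eval p.rep (X 0 * b - X 1 * a) = 0}.Finite

namespace PlaneCurve

open scoped Matrix

section Homogeneous

attribute [local instance] MvPolynomial.gradedAlgebra

variable {a b : S3} {m n : ℕ}

lemma homogeneousComponent_add_mul (hb : b.IsHomogeneous m) (n : ℕ) (a : S3) :
    homogeneousComponent (n + m) (a * b) = homogeneousComponent n a * b := by
  have h := DirectSum.coe_decompose_mul_add_of_right_mem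
    (homogeneousSubmodule (Fin 3) ℂ) (i := n) (a := a) hb
  rwa [← decomposition.decompose'_apply, ← decomposition.decompose'_apply]

lemma homogeneousComponent_mul_of_lt (hb : b.IsHomogeneous m) (hn : n < m) (a : S3) :
    homogeneousComponent n (a * b) = 0 := by
  have h := DirectSum.coe_decompose_mul_of_right_mem_of_not_le
    (homogeneousSubmodule (Fin 3) ℂ) (n := n) (a := a) hb (by omega)
  rwa [← decomposition.decompose'_apply]

lemma eq_of_homogeneousComponent_eq (h : ∀ k, homogeneousComponent k a = homogeneousComponent k b) :
    a = b := by
  ext s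
  have := congrArg (coeff s) (h s.degree)
  simpa [coeff_homogeneousComponent] using this

/-- A cofactor of a nonzero homogeneous polynomial in a homogeneous polynomial is homogeneous. -/
lemma isHomogeneous_of_mul (hb : b.IsHomogeneous m) (hb0 : b ≠ 0)
    (hab : (a * b).IsHomogeneous (n + m)) : a.IsHomogeneous n := by
  suffices h : homogeneousComponent n a = a from h ▸ homogeneousComponent_isHomogeneous n a
  apply mul_right_cancel₀ hb0
  rw [← homogeneousComponent_add_mul hb, homogeneousComponent_eq_self hab]

lemma eq_zero_of_mul_of_lt (hb : b.IsHomogeneous m) (hab : (a * b).IsHomogeneous n) (hn : n < m) :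
    a * b = 0 := by
  rw [← homogeneousComponent_eq_self hab, homogeneousComponent_mul_of_lt hb hn]

end Homogeneous

section Primitive

/-- A nonzero vector of polynomials all of whose parallel vectors are its multiples. -/
def IsPrimitive (u : Fin 3 → S3) : Prop :=
  u ≠ 0 ∧ ∀ v, u ⨯₃ v = 0 → ∃ c : S3, v = c • u

lemma cross_eq_zero_iff (u v : Fin 3 → S3) :
    u ⨯₃ v = 0 ↔ ∀ i j, u i * v j = u j * v i := by
  rw [cross_apply]
  constructor
  · intro h
    have h0 := congrFun h 0
    have h1 := congrFun h 1
    have h2 := congrFun h 2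
    simp [sub_eq_zero] at h0 h1 h2
    intro i j
    fin_cases i <;> fin_cases j <;> simp [h0, h1, h2]
  · intro h
    ext1 i
    fin_cases i <;> simp [h 1 2, h 2 0, h 0 1]

lemma isPrimitive_of_forall_prime {u : Fin 3 → S3} (hu : u ≠ 0)
    (h : ∀ p : S3, Prime p → ¬ ∀ i, p ∣ u i) : IsPrimitive u := by
  classical
  let _ : NormalizedGCDMonoid S3 := Classical.choice inferInstance
  obtain ⟨i, hi⟩ := Function.ne_iff.mp hu
  rw [Pi.zero_apply] at hi
  refine ⟨hu, fun v hv => ?_⟩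
  rw [cross_eq_zero_iff] at hv
  have hg : IsUnit (Finset.univ.gcd u) := by
    by_contra hg
    have h0 : Finset.univ.gcd u ≠ 0 := fun h0 =>
      hi (Finset.gcd_eq_zero_iff.mp h0 i (Finset.mem_univ i))
    obtain ⟨p, hp, hpg⟩ := WfDvdMonoid.exists_irreducible_factor hg h0
    exact h p hp.prime fun j => hpg.trans (Finset.gcd_dvd (Finset.mem_univ j))
  have hdvd : u i ∣ Finset.univ.gcd fun j => u j * v i :=
    Finset.dvd_gcd fun j _ => ⟨v j, (hv i j).symm⟩
  rw [(Finset.gcd_mul_right' _ _ (v i)).dvd_iff_dvd_right, hg.dvd_mul_left] at hdvd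
  obtain ⟨c, hc⟩ := hdvd
  refine ⟨c, funext fun j => mul_left_cancel₀ hi ?_⟩
  rw [hv i j, hc, Pi.smul_apply, smul_eq_mul]
  ring

end Primitive

section Gradient

/-- The gradient of `f`. -/
def grad (f : S3) : Fin 3 → S3 := fun i => pderiv i f

lemma mem_jacSyz_iff {f : S3} {v : Fin 3 → S3} : v ∈ jacSyz f ↔ v ⬝ᵥ grad f = 0 := by
  simp only [dotProduct, Fin.sum_univ_three, grad]
  rfl

lemma totalDegree_pderiv_lt {p : S3} {i : Fin 3} (h : pderiv i p ≠ 0) :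
    (pderiv i p).totalDegree < p.totalDegree := by
  obtain ⟨s, hs, hdeg⟩ := (pderiv i p).support.exists_mem_eq_sup
    (support_nonempty.mpr h) fun s => s.sum fun _ e => e
  rw [totalDegree, hdeg]
  rw [mem_support_iff, coeff_pderiv] at hs
  have := le_totalDegree (mem_support_iff.mpr (left_ne_zero_of_mul hs))
  rw [Finsupp.sum_add_index' (by simp) (by simp), Finsupp.sum_single_index rfl] at this
  omega

lemma isUnit_of_forall_pderiv_eq_zero {p : S3} (hp : p ≠ 0) (h : ∀ i, pderiv i p = 0) :
    IsUnit p := by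
  have hC : p = C (coeff 0 p) := by
    ext s
    rw [coeff_C]
    split_ifs with hs
    · rw [hs]
    · obtain ⟨i, hi⟩ := Finsupp.ne_iff.mp (Ne.symm hs)
      have hle : Finsupp.single i 1 ≤ s := by
        rw [Finsupp.single_le_iff]
        exact Nat.one_le_iff_ne_zero.mpr hi
      have := coeff_pderiv (i := i) p (s - Finsupp.single i 1)
      rw [h i, coeff_zero, tsub_add_cancel_of_le hle] at this
      exact (mul_eq_zero.mp this.symm).resolve_right (Nat.cast_add_one_ne_zero _)
  rw [hC] at hp ⊢
  exact (isUnit_iff_ne_zero.mpr fun h0 => hp (by rw [h0, C_0])).map C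

lemma grad_isPrimitive {f : S3} {d : ℕ} (hd : d ≠ 0) (hf : f.IsHomogeneous d)
    (hred : Squarefree f) : IsPrimitive (grad f) := by
  have hdC : IsUnit (d : S3) := by
    rw [← map_natCast C]
    exact (isUnit_iff_ne_zero.mpr (Nat.cast_ne_zero.mpr hd)).map C
  have heuler : ∑ i, X i * grad f i = (d : S3) * f := by
    rw [← nsmul_eq_mul]
    exact hf.sum_X_mul_pderiv
  refine isPrimitive_of_forall_prime (fun h => ?_) fun p hp hdvd => ?_
  · rw [h] at heuler
    simp [hdC.ne_zero, hred.ne_zero] at heuler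
  · have hpf : p ∣ f := by
      rw [← hdC.dvd_mul_left, ← heuler]
      exact Finset.dvd_sum fun i _ => (hdvd i).mul_left _
    obtain ⟨m, rfl⟩ := hpf
    have hpm : ¬ p ∣ m := fun h => hp.not_isUnit (hred p (mul_dvd_mul_left p h))
    refine hp.not_isUnit (isUnit_of_forall_pderiv_eq_zero hp.ne_zero fun i => ?_)
    by_contra hne
    have h1 : p ∣ pderiv i p * m + p * pderiv i m := pderiv_mul (R := ℂ) ▸ hdvd i
    rw [dvd_add_left (dvd_mul_right p _)] at h1
    obtain ⟨q, hq⟩ := (hp.dvd_or_dvd h1).resolve_right hpm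
    have hlt := totalDegree_pderiv_lt hne
    rw [hq] at hne hlt
    rw [totalDegree_mul_of_isDomain (left_ne_zero_of_mul hne) (right_ne_zero_of_mul hne)] at hlt
    omega

end Gradient

end PlaneCurve

namespace PlaneCurve

open scoped Matrix

section Syzygies

variable {u v w : Fin 3 → S3} {f g : S3} {d e k n r : ℕ}

/-- The degree `n` component of a vector of polynomials. -/
def vecComponent (n : ℕ) (v : Fin 3 → S3) : Fin 3 → S3 := fun i => homogeneousComponent n (v i)

lemma vecComponent_isHomogeneous (n : ℕ) (v : Fin 3 → S3) (i : Fin 3) :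
    (vecComponent n v i).IsHomogeneous n := homogeneousComponent_isHomogeneous n (v i)

lemma vecComponent_eq_self (hv : ∀ i, (v i).IsHomogeneous n) : vecComponent n v = v :=
  funext fun i => homogeneousComponent_eq_self (hv i)

lemma vecComponent_cross (hu : ∀ i, (u i).IsHomogeneous r) (n : ℕ) (v : Fin 3 → S3) :
    vecComponent (n + r) (u ⨯₃ v) = u ⨯₃ vecComponent n v := by
  ext1 i
  fin_cases i <;>
    simp [vecComponent, cross_apply, mul_comm (u _), homogeneousComponent_add_mul (hu _)]

lemma vecComponent_cross_of_lt (hu : ∀ i, (u i).IsHomogeneous r) (hn : n < r) (v : Fin 3 → S3) :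
    vecComponent n (u ⨯₃ v) = 0 := by
  ext1 i
  fin_cases i <;>
    simp [vecComponent, cross_apply, mul_comm (u _), homogeneousComponent_mul_of_lt (hu _) hn]

lemma vecComponent_smul (hw : ∀ i, (w i).IsHomogeneous e) (n : ℕ) (g : S3) :
    vecComponent (n + e) (g • w) = homogeneousComponent n g • w := by
  ext1 i
  simp [vecComponent, homogeneousComponent_add_mul (hw _)]

lemma vecComponent_smul_of_lt (hw : ∀ i, (w i).IsHomogeneous e) (hn : n < e) (g : S3) :
    vecComponent n (g • w) = 0 := by
  ext1 i
  simp [vecComponent, homogeneousComponent_mul_of_lt (hw _) hn]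

lemma homogeneousComponent_dotProduct (hw : ∀ i, (w i).IsHomogeneous e) (n : ℕ)
    (v : Fin 3 → S3) : homogeneousComponent (n + e) (v ⬝ᵥ w) = vecComponent n v ⬝ᵥ w := by
  simp [vecComponent, dotProduct, map_sum, homogeneousComponent_add_mul (hw _)]

lemma cross_isHomogeneous (hu : ∀ i, (u i).IsHomogeneous r) (hv : ∀ i, (v i).IsHomogeneous k)
    (i : Fin 3) : ((u ⨯₃ v) i).IsHomogeneous (r + k) := by
  fin_cases i <;> simpa [cross_apply] using ((hu _).mul (hv _)).sub ((hu _).mul (hv _))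

lemma vecComponent_mem_jacSyz (hf : f.IsHomogeneous d) (hv : v ∈ jacSyz f) (n : ℕ) :
    vecComponent n v ∈ jacSyz f := by
  rw [mem_jacSyz_iff] at hv ⊢
  rw [← homogeneousComponent_dotProduct (w := grad f) (fun i => hf.pderiv), hv, map_zero]

/-- A nonzero Jacobian syzygy of minimal degree is primitive. -/
lemma isPrimitive_of_minimal_degree (hf : f.IsHomogeneous d) (hu : u ∈ jacSyz f) (hu0 : u ≠ 0)
    (hur : ∀ i, (u i).IsHomogeneous r)
    (hmin : ∀ m, m < r → ∀ v ∈ jacSyz f, (∀ i, (v i).IsHomogeneous m) → v = 0) :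
    IsPrimitive u := by
  refine isPrimitive_of_forall_prime hu0 fun p hp hdvd => ?_
  choose v hv using hdvd
  obtain rfl : u = p • v := funext hv
  have hvs : v ∈ jacSyz f := by
    rw [mem_jacSyz_iff, smul_dotProduct, smul_eq_mul] at hu
    rw [mem_jacSyz_iff]
    exact (mul_eq_zero.mp hu).resolve_left hp.ne_zero
  have hpdeg : p.totalDegree ≠ 0 := fun h0 => by
    have hpC := totalDegree_eq_zero_iff_eq_C.mp h0
    apply hp.not_isUnit
    rw [hpC]
    exact (isUnit_iff_ne_zero.mpr fun h => hp.ne_zero (by rw [hpC, h, C_0])).map C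
  obtain ⟨i, hi⟩ := Function.ne_iff.mp hu0
  have hvi : v i ≠ 0 := right_ne_zero_of_mul hi
  have hdeg := (hur i).totalDegree hi
  rw [Pi.smul_apply, smul_eq_mul, totalDegree_mul_of_isDomain hp.ne_zero hvi] at hdeg
  refine hvi (eq_of_homogeneousComponent_eq fun m => ?_)
  rw [map_zero]
  rcases lt_or_ge m r with hm | hm
  · exact congrFun (hmin m hm _ (vecComponent_mem_jacSyz hf hvs m)
      (vecComponent_isHomogeneous m v)) i
  · exact homogeneousComponent_eq_zero m (v i) (by omega)

/-- A primitive homogeneous syzygy `u`, of degree `r`, of a primitive vector `w` of forms of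
degree `e`. -/
structure IsSyzPair (u w : Fin 3 → S3) (r e : ℕ) : Prop where
  hom_left : ∀ i, (u i).IsHomogeneous r
  hom_right : ∀ i, (w i).IsHomogeneous e
  dot_eq_zero : u ⬝ᵥ w = 0
  primitive_left : IsPrimitive u
  primitive_right : IsPrimitive w

/-- The ideal of all `g` such that `g • w` is a cross product `u ⨯₃ v`. For a syzygy `u` of `w`,
this is the ideal of the zero scheme of the section defined by `u`. -/
def crossIdeal (u w : Fin 3 → S3) : Ideal S3 where
  carrier := {g | ∃ v, u ⨯₃ v = g • w}
  add_mem' := by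
    rintro a b ⟨v, hv⟩ ⟨v', hv'⟩
    exact ⟨v + v', by rw [map_add, hv, hv', add_smul]⟩
  zero_mem' := ⟨0, by simp⟩
  smul_mem' := by
    rintro c a ⟨v, hv⟩
    exact ⟨c • v, by rw [map_smul, hv, smul_smul, smul_eq_mul]⟩

lemma mem_crossIdeal_iff : g ∈ crossIdeal u w ↔ ∃ v, u ⨯₃ v = g • w := Iff.rfl

lemma IsPrimitive.smul_injective (hw : IsPrimitive w) :
    Function.Injective fun g : S3 => g • w := smul_left_injective S3 hw.1

lemma dot_eq_zero_of_cross (hv : u ⨯₃ v = g • w) (hg : g ≠ 0) :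
    v ⬝ᵥ w = 0 := by
  have h1 := dot_cross_self u v
  rw [hv, dotProduct_smul, smul_eq_mul] at h1
  exact (mul_eq_zero.mp h1).resolve_left hg

namespace IsSyzPair

/-- Cross multiplication by `u` maps syzygies of `w` to multiples of `w`. -/
lemma exists_cross_eq (h : IsSyzPair u w r e) (hv : v ⬝ᵥ w = 0) :
    ∃ g : S3, u ⨯₃ v = g • w := by
  apply h.primitive_right.2
  rw [← cross_anticomm, cross_cross_eq_smul_sub_smul, h.dot_eq_zero, hv]
  simp

lemma isHomogeneous_of_cross (h : IsSyzPair u w r e) (hv : ∀ i, (v i).IsHomogeneous k)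
    (huv : u ⨯₃ v = g • w) (hn : n + e = r + k) : g.IsHomogeneous n := by
  obtain ⟨i, hi⟩ := Function.ne_iff.mp h.primitive_right.1
  refine isHomogeneous_of_mul (h.hom_right i) hi ?_
  have := cross_isHomogeneous h.hom_left hv i
  rwa [huv, ← hn] at this

/-- A nonzero form of degree `n` in the cross ideal comes from a homogeneous syzygy. -/
lemma exists_homogeneous_of_mem (h : IsSyzPair u w r e) (hg : g ∈ crossIdeal u w)
    (hgn : g.IsHomogeneous n) (hg0 : g ≠ 0) :
    ∃ k, k + r = n + e ∧ ∃ v, (∀ i, (v i).IsHomogeneous k) ∧ v ⬝ᵥ w = 0 ∧ u ⨯₃ v = g • w := by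
  obtain ⟨v, hv⟩ := hg
  have hc : vecComponent (n + e) (u ⨯₃ v) = g • w := by
    rw [hv, vecComponent_smul h.hom_right, homogeneousComponent_eq_self hgn]
  rcases lt_or_ge (n + e) r with hlt | hle
  · rw [vecComponent_cross_of_lt h.hom_left hlt] at hc
    exact absurd ((smul_eq_zero.mp hc.symm).resolve_right h.primitive_right.1) hg0
  · obtain ⟨k, hk⟩ := Nat.exists_eq_add_of_le' hle
    rw [hk, vecComponent_cross h.hom_left] at hc
    exact ⟨k, hk.symm, _, vecComponent_isHomogeneous k v, dot_eq_zero_of_cross hc hg0, hc⟩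

lemma homogeneousComponent_mem (h : IsSyzPair u w r e) (hg : g ∈ crossIdeal u w) (n : ℕ) :
    homogeneousComponent n g ∈ crossIdeal u w := by
  obtain ⟨v, hv⟩ := hg
  have hc := vecComponent_smul h.hom_right n g
  rw [← hv] at hc
  rcases lt_or_ge (n + e) r with hlt | hle
  · rw [vecComponent_cross_of_lt h.hom_left hlt] at hc
    exact ⟨0, by rw [map_zero, hc]⟩
  · obtain ⟨k, hk⟩ := Nat.exists_eq_add_of_le' hle
    rw [hk, vecComponent_cross h.hom_left] at hc
    exact ⟨_, hc⟩

end IsSyzPair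

end Syzygies

section Saturation

lemma mem_span_pair_of_X_mul_mem {c : S3} (h : X 2 * c ∈ Ideal.span {(X 0 : S3), X 1}) :
    c ∈ Ideal.span {(X 0 : S3), X 1} := by
  have hset : ({X 0, X 1} : Set S3) = X '' ({0, 1} : Set (Fin 3)) := by
    simp [Set.image_insert_eq]
  rw [hset, mem_ideal_span_X_image] at h ⊢
  intro m hm
  obtain ⟨i, hi, hne⟩ := h (Finsupp.single 2 1 + m) (by
    rw [mem_support_iff, coeff_X_mul]
    exact mem_support_iff.mp hm)
  refine ⟨i, hi, ?_⟩
  rcases hi with rfl | rfl <;> simpa using hne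

/-- Exactness of the Koszul complex of the variables in its middle term. -/
lemma koszul_exact {a b c : S3} (h : X 0 * a - X 1 * b + X 2 * c = 0) :
    ∃ α β γ : S3, c = X 1 * α - X 0 * β ∧ b = X 2 * α - X 0 * γ ∧ a = X 2 * β - X 1 * γ := by
  obtain ⟨s, t, hst⟩ := Ideal.mem_span_pair.mp (mem_span_pair_of_X_mul_mem (c := c)
    (Ideal.mem_span_pair.mpr ⟨-a, b, by linear_combination -h⟩))
  have h1 : X 0 * (a + X 2 * s) = X 1 * (b - X 2 * t) := by
    linear_combination h - X 2 * hst.symm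
  have hX0 : Prime (X 0 : S3) := X_prime
  have hndvd : ¬ (X 0 : S3) ∣ X 1 := by
    rw [X_dvd_X]
    simp
  obtain ⟨q, hq⟩ := (hX0.dvd_or_dvd (Dvd.intro _ h1)).resolve_left hndvd
  refine ⟨t, -s, -q, by linear_combination -hst, by linear_combination hq, ?_⟩
  apply mul_left_cancel₀ hX0.ne_zero
  rw [hq] at h1
  linear_combination h1

lemma exists_smul_of_X_smul_eq {A B : Fin 3 → S3} (h : (X 1 : S3) • A = (X 0 : S3) • B) :
    ∃ v : Fin 3 → S3, A = (X 0 : S3) • v := by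
  have hX0 : Prime (X 0 : S3) := X_prime
  have hndvd : ¬ (X 0 : S3) ∣ X 1 := by
    rw [X_dvd_X]
    simp
  have hdvd : ∀ i, (X 0 : S3) ∣ A i := fun i =>
    (hX0.dvd_or_dvd (Dvd.intro _ (congrFun h i).symm)).resolve_left hndvd
  choose v hv using hdvd
  exact ⟨v, funext hv⟩

variable {u w : Fin 3 → S3} {g : S3}

/-- The cross ideal of a primitive vector is saturated. -/
lemma mem_crossIdeal_of_forall_X_mul_mem (hu : IsPrimitive u)
    (h : ∀ i, X i * g ∈ crossIdeal u w) : g ∈ crossIdeal u w := by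
  choose A hA using h
  have hpar : ∀ i j, ∃ c : S3, (X j : S3) • A i - (X i : S3) • A j = c • u := fun i j => by
    apply hu.2
    rw [map_sub, map_smul, map_smul, hA, hA, smul_smul, smul_smul, ← sub_smul]
    rw [show X j * (X i * g) - X i * (X j * g) = 0 by ring, zero_smul]
  obtain ⟨c, hc⟩ := hpar 0 1
  obtain ⟨b, hb⟩ := hpar 0 2
  obtain ⟨a, ha⟩ := hpar 1 2
  have hk : (X 0 * a - X 1 * b + X 2 * c) • u = 0 := by
    rw [add_smul, sub_smul, mul_smul, mul_smul, mul_smul, ← ha, ← hb, ← hc]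
    module
  obtain ⟨α, β, γ, rfl, rfl, rfl⟩ :=
    koszul_exact ((smul_eq_zero.mp hk).resolve_right hu.1)
  obtain ⟨v, hv⟩ := exists_smul_of_X_smul_eq (A := A 0 - α • u) (B := A 1 - β • u)
    (by linear_combination (norm := module) hc)
  refine ⟨v, smul_right_injective _ (X_ne_zero (R := ℂ) (0 : Fin 3)) ?_⟩
  simp only
  rw [← map_smul, ← hv, map_sub, map_smul, cross_self, hA, smul_zero, sub_zero, mul_smul]

end Saturation

end PlaneCurve

namespace PlaneCurve

open scoped Matrix
open Module

section Finrank

variable {M N : Type*} [AddCommGroup M] [Module ℂ M] [AddCommGroup N] [Module ℂ N]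

lemma finrank_map_add_finrank_inf_ker (V : Submodule ℂ M) [FiniteDimensional ℂ V]
    (φ : M →ₗ[ℂ] N) :
    finrank ℂ (V.map φ) + finrank ℂ (V ⊓ LinearMap.ker φ : Submodule ℂ M) = finrank ℂ V := by
  rw [← LinearMap.finrank_range_add_finrank_ker (φ.domRestrict V), LinearMap.range_domRestrict,
    LinearMap.ker_domRestrict, ← Submodule.finrank_map_subtype_eq V, Submodule.map_comap_subtype]

lemma finrank_map_of_injective (V : Submodule ℂ M) {φ : M →ₗ[ℂ] N} (hφ : Function.Injective φ) :
    finrank ℂ (V.map φ) = finrank ℂ V :=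
  (Submodule.equivMapOfInjective φ hφ V).finrank_eq.symm

end Finrank

instance (n : ℕ) : FiniteDimensional ℂ (homogeneousSubmodule (Fin 3) ℂ n) :=
  Module.Finite.iff_fg.mpr (homogeneousSubmodule_fg (Fin 3) ℂ n)

lemma finrank_homogeneousSubmodule (n : ℕ) :
    finrank ℂ (homogeneousSubmodule (Fin 3) ℂ n) = (n + 2).choose 2 := by
  classical
  have hset : {s : Fin 3 →₀ ℕ | s.degree = n} =
      ((Finset.univ : Finset (Fin 3)).finsuppAntidiag n : Set (Fin 3 →₀ ℕ)) := by
    ext s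
    simp [Finsupp.degree_eq_sum]
  rw [homogeneousSubmodule_eq_finsupp_supported, hset,
    (AddMonoidAlgebra.supportedEquivFinsupp _).finrank_eq, finrank_finsupp_self,
    ← Nat.card_eq_fintype_card, Nat.card_coe_set_eq, Set.ncard_coe_finset,
    Finset.card_finsuppAntidiag_nat_eq_choose, Finset.card_univ, Fintype.card_fin,
    show 3 + n - 1 = n + 2 by omega, Nat.choose_symm_add]

lemma two_mul_finrank_homogeneousSubmodule (n : ℕ) :
    2 * (finrank ℂ (homogeneousSubmodule (Fin 3) ℂ n) : ℤ) = (n + 1) * (n + 2) := by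
  rw [finrank_homogeneousSubmodule]
  induction n with
  | zero => norm_num
  | succ n ih =>
    rw [show n + 1 + 2 = (n + 2) + 1 by omega, Nat.choose_succ_succ' (n + 2) 1, Nat.choose_one_right]
    push_cast
    linarith

/-- The degree `n` part of an ideal. -/
def degPart (I : Ideal S3) (n : ℕ) : Submodule ℂ S3 :=
  I.restrictScalars ℂ ⊓ homogeneousSubmodule (Fin 3) ℂ n

lemma mem_degPart {I : Ideal S3} {n : ℕ} {g : S3} :
    g ∈ degPart I n ↔ g ∈ I ∧ g.IsHomogeneous n := Iff.rfl

instance (I : Ideal S3) (n : ℕ) : FiniteDimensional ℂ (degPart I n) :=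
  Submodule.finiteDimensional_inf_right _ _

lemma degPart_mono {I J : Ideal S3} (h : I ≤ J) (n : ℕ) : degPart I n ≤ degPart J n :=
  inf_le_inf_right _ h

lemma milnorDim_add_finrank_degPart (f : S3) (n : ℕ) :
    milnorDim f n + finrank ℂ (degPart (jacobianIdeal f) n) =
      finrank ℂ (homogeneousSubmodule (Fin 3) ℂ n) := by
  rw [← Submodule.finrank_quotient_add_finrank (Submodule.comap
    (homogeneousSubmodule (Fin 3) ℂ n).subtype
    (Submodule.restrictScalars ℂ (jacobianIdeal f))), milnorDim, degPart, inf_comm,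
    ← Submodule.map_comap_subtype, Submodule.finrank_map_subtype_eq]

/-- The vectors of forms of degree `n`. -/
def homVec (n : ℕ) : Submodule ℂ (Fin 3 → S3) :=
  LinearMap.range ((homogeneousSubmodule (Fin 3) ℂ n).subtype.compLeft (Fin 3))

instance (n : ℕ) : FiniteDimensional ℂ (homVec n) := by
  unfold homVec
  infer_instance

lemma mem_homVec {n : ℕ} {v : Fin 3 → S3} : v ∈ homVec n ↔ ∀ i, (v i).IsHomogeneous n := by
  constructor
  · rintro ⟨v, rfl⟩ i
    exact (v i).2
  · intro h
    exact ⟨fun i => ⟨v i, h i⟩, rfl⟩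

lemma finrank_homVec (n : ℕ) :
    finrank ℂ (homVec n) = 3 * finrank ℂ (homogeneousSubmodule (Fin 3) ℂ n) := by
  rw [homVec, LinearMap.finrank_range_of_inj, finrank_pi_fintype]
  · simp
  · intro v v' h
    exact funext fun i => Subtype.ext (congrFun h i)

/-- The degree `k` part of the syzygy module of `w`. -/
def syzPart (w : Fin 3 → S3) (k : ℕ) : Submodule ℂ (Fin 3 → S3) :=
  homVec k ⊓ LinearMap.ker ((Fintype.linearCombination S3 w).restrictScalars ℂ)

lemma mem_syzPart {w v : Fin 3 → S3} {k : ℕ} :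
    v ∈ syzPart w k ↔ (∀ i, (v i).IsHomogeneous k) ∧ v ⬝ᵥ w = 0 := by
  rw [syzPart, Submodule.mem_inf, mem_homVec]
  rfl

instance (w : Fin 3 → S3) (k : ℕ) : FiniteDimensional ℂ (syzPart w k) :=
  Submodule.finiteDimensional_inf_left _ _

lemma finrank_degPart_span_add {w : Fin 3 → S3} {e : ℕ} (hw : ∀ i, (w i).IsHomogeneous e) (k : ℕ) :
    finrank ℂ (degPart (Ideal.span (Set.range w)) (k + e)) + finrank ℂ (syzPart w k) =
      3 * finrank ℂ (homogeneousSubmodule (Fin 3) ℂ k) := by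
  suffices heq : degPart (Ideal.span (Set.range w)) (k + e) =
      (homVec k).map ((Fintype.linearCombination S3 w).restrictScalars ℂ) by
    rw [← finrank_homVec, ← finrank_map_add_finrank_inf_ker (homVec k)
      ((Fintype.linearCombination S3 w).restrictScalars ℂ), syzPart, heq]
  have hrange := Fintype.range_linearCombination S3 w
  ext g
  rw [mem_degPart, Ideal.span, ← hrange]
  constructor
  · rintro ⟨⟨v, rfl⟩, hgn⟩
    refine ⟨vecComponent k v, mem_homVec.mpr (vecComponent_isHomogeneous k v), ?_⟩
    rw [← homogeneousComponent_eq_self hgn]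
    exact (homogeneousComponent_dotProduct hw k v).symm
  · rintro ⟨v, hv, rfl⟩
    refine ⟨⟨v, rfl⟩, ?_⟩
    exact IsHomogeneous.sum _ _ _ fun i _ => (mem_homVec.mp hv i).mul (hw i)

lemma IsSyzPair.finrank_syzPart {u w : Fin 3 → S3} {r e : ℕ} (h : IsSyzPair u w r e) {m n : ℕ}
    (hn : n + e = m + r + r) :
    finrank ℂ (syzPart w (m + r)) = finrank ℂ (degPart (crossIdeal u w) n) +
      finrank ℂ (homogeneousSubmodule (Fin 3) ℂ m) := by
  have hinj : ∀ {y : Fin 3 → S3}, IsPrimitive y →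
      Function.Injective ((LinearMap.toSpanSingleton S3 _ y).restrictScalars ℂ) :=
    fun hy => hy.smul_injective
  have himage : (syzPart w (m + r)).map ((crossProduct u).restrictScalars ℂ) =
      (degPart (crossIdeal u w) n).map
        ((LinearMap.toSpanSingleton S3 _ w).restrictScalars ℂ) := by
    ext y
    constructor
    · rintro ⟨v, hv, rfl⟩
      obtain ⟨hvk, hvw⟩ := mem_syzPart.mp hv
      obtain ⟨g, hg⟩ := h.exists_cross_eq hvw
      exact ⟨g, ⟨⟨v, hg⟩, h.isHomogeneous_of_cross hvk hg (by omega)⟩, hg.symm⟩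
    · rintro ⟨g, ⟨hg, hgn⟩, rfl⟩
      by_cases hg0 : g = 0
      · rw [hg0, map_zero]
        exact zero_mem _
      · obtain ⟨k, hk, v, hvk, hvw, huv⟩ := h.exists_homogeneous_of_mem hg hgn hg0
        obtain rfl : k = m + r := by omega
        exact ⟨v, mem_syzPart.mpr ⟨hvk, hvw⟩, huv⟩
  have hker : syzPart w (m + r) ⊓ LinearMap.ker ((crossProduct u).restrictScalars ℂ) =
      (homogeneousSubmodule (Fin 3) ℂ m).map
        ((LinearMap.toSpanSingleton S3 _ u).restrictScalars ℂ) := by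
    ext v
    constructor
    · rintro ⟨hv, huv⟩
      obtain ⟨hvk, hvw⟩ := mem_syzPart.mp hv
      obtain ⟨c, rfl⟩ := h.primitive_left.2 v huv
      obtain ⟨i, hi⟩ := Function.ne_iff.mp h.primitive_left.1
      exact ⟨c, isHomogeneous_of_mul (h.hom_left i) hi (hvk i), rfl⟩
    · rintro ⟨c, hc, rfl⟩
      refine ⟨mem_syzPart.mpr ⟨fun i => IsHomogeneous.mul hc (h.hom_left i), ?_⟩, ?_⟩
      · change (c • u) ⬝ᵥ w = 0
        rw [smul_dotProduct, h.dot_eq_zero, smul_zero]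
      · change u ⨯₃ (c • u) = 0
        rw [map_smul, cross_self, smul_zero]
  rw [← finrank_map_add_finrank_inf_ker (syzPart w (m + r)) ((crossProduct u).restrictScalars ℂ),
    ← finrank_map_of_injective (degPart (crossIdeal u w) n) (hinj h.primitive_right),
    ← finrank_map_of_injective (homogeneousSubmodule (Fin 3) ℂ m) (hinj h.primitive_left),
    himage, hker]

/-- The Hilbert function of the complete intersection of a prime form and a form which is not a
multiple of it. -/
lemma finrank_degPart_span_pair {l q : S3} {a b : ℕ} (hl : Prime l) (hq : ¬ l ∣ q)
    (hla : l.IsHomogeneous a) (hqb : q.IsHomogeneous b) (n : ℕ) :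
    finrank ℂ (degPart (Ideal.span {l, q}) (n + a + b)) +
      finrank ℂ (homogeneousSubmodule (Fin 3) ℂ n) =
      finrank ℂ (homogeneousSubmodule (Fin 3) ℂ (n + b)) +
      finrank ℂ (homogeneousSubmodule (Fin 3) ℂ (n + a)) := by
  have hq0 : q ≠ 0 := fun h => hq (h ▸ dvd_zero l)
  have hinj : ∀ {g : S3}, g ≠ 0 → Function.Injective (LinearMap.mulRight ℂ g) :=
    fun hg => mul_left_injective₀ hg
  have hsup : degPart (Ideal.span {l, q}) (n + a + b) =
      (homogeneousSubmodule (Fin 3) ℂ (n + b)).map (LinearMap.mulRight ℂ l) ⊔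
        (homogeneousSubmodule (Fin 3) ℂ (n + a)).map (LinearMap.mulRight ℂ q) := by
    ext g
    rw [mem_degPart, Submodule.mem_sup]
    constructor
    · rintro ⟨hg, hgn⟩
      obtain ⟨s, t, hst⟩ := Ideal.mem_span_pair.mp hg
      refine ⟨_, ⟨homogeneousComponent (n + b) s, homogeneousComponent_isHomogeneous _ _, rfl⟩,
        _, ⟨homogeneousComponent (n + a) t, homogeneousComponent_isHomogeneous _ _, rfl⟩, ?_⟩
      rw [← homogeneousComponent_eq_self hgn, ← hst, map_add, LinearMap.mulRight_apply,
        LinearMap.mulRight_apply, homogeneousComponent_add_mul hqb, add_right_comm,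
        homogeneousComponent_add_mul hla]
    · rintro ⟨_, ⟨s, hs, rfl⟩, _, ⟨t, ht, rfl⟩, rfl⟩
      refine ⟨Ideal.mem_span_pair.mpr ⟨s, t, rfl⟩, IsHomogeneous.add ?_ (IsHomogeneous.mul ht hqb)⟩
      rw [add_right_comm]
      exact IsHomogeneous.mul hs hla
  have hinf : (homogeneousSubmodule (Fin 3) ℂ n).map (LinearMap.mulRight ℂ (l * q)) =
      (homogeneousSubmodule (Fin 3) ℂ (n + b)).map (LinearMap.mulRight ℂ l) ⊓
        (homogeneousSubmodule (Fin 3) ℂ (n + a)).map (LinearMap.mulRight ℂ q) := by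
    ext g
    constructor
    · rintro ⟨c, hc, rfl⟩
      refine ⟨⟨c * q, IsHomogeneous.mul hc hqb, ?_⟩, ⟨c * l, IsHomogeneous.mul hc hla, ?_⟩⟩ <;>
        simp only [LinearMap.mulRight_apply] <;> ring
    · rintro ⟨⟨s, hs, rfl⟩, ⟨t, ht, hst⟩⟩
      rw [LinearMap.mulRight_apply, LinearMap.mulRight_apply] at hst
      obtain ⟨c, rfl⟩ := (hl.dvd_or_dvd (Dvd.intro_left _ hst.symm)).resolve_right hq
      refine ⟨c, isHomogeneous_of_mul hla hl.ne_zero (mul_comm l c ▸ ht), ?_⟩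
      rw [LinearMap.mulRight_apply, LinearMap.mulRight_apply, ← hst]
      ring
  rw [← finrank_map_of_injective (homogeneousSubmodule (Fin 3) ℂ n)
    (hinj (mul_ne_zero hl.ne_zero hq0)),
    ← finrank_map_of_injective (homogeneousSubmodule (Fin 3) ℂ (n + b)) (hinj hl.ne_zero),
    ← finrank_map_of_injective (homogeneousSubmodule (Fin 3) ℂ (n + a)) (hinj hq0),
    hsup, hinf, Submodule.finrank_sup_add_finrank_inf_eq]

end PlaneCurve

namespace PlaneCurve

open Module Filter

section Saturated

variable {I : Ideal S3}

lemma prime_of_isHomogeneous_one {l : S3} (hl : l.IsHomogeneous 1) (hl0 : l ≠ 0) : Prime l := by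
  apply Irreducible.prime
  refine irreducible_of_totalDegree_eq_one (hl.totalDegree hl0) fun x hx => ?_
  obtain ⟨s, hs⟩ := ne_zero_iff.mp hl0
  exact isUnit_iff_ne_zero.mpr fun h0 => hs (zero_dvd_iff.mp (h0 ▸ hx s))

/-- There is a linear form which is a nonzerodivisor modulo a given saturated ideal. -/
lemma exists_linear_regular (hsat : ∀ g, (∀ i, X i * g ∈ I) → g ∈ I) :
    ∃ h : S3, h.IsHomogeneous 1 ∧ ∀ g, g * h ∈ I → g ∈ I := by
  let W := homogeneousSubmodule (Fin 3) ℂ 1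
  let A := associatedPrimes S3 (S3 ⧸ I)
  have : Finite A := (associatedPrimes.finite S3 (S3 ⧸ I)).to_subtype
  let p : A → Subspace ℂ W := fun P => (P.1.restrictScalars ℂ).comap W.subtype
  have hp : ∀ P, p P ≠ ⊤ := fun P hP => by
    obtain ⟨hprime, x, hx⟩ := (isAssociatedPrime_iff ..).mp P.2
    obtain ⟨g, rfl⟩ := Ideal.Quotient.mk_surjective x
    have hX : ∀ i, X i ∈ P.1 := fun i => by
      have : (⟨X i, isHomogeneous_X ℂ i⟩ : W) ∈ p P := hP ▸ Submodule.mem_top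
      exact this
    have hg : g ∈ I := hsat g fun i => by
      have := hX i
      rw [hx, Submodule.mem_colon_singleton] at this
      rw [← Ideal.Quotient.eq_zero_iff_mem]
      exact this
    apply hprime.ne_top
    rw [Ideal.eq_top_iff_one, hx, Submodule.mem_colon_singleton,
      Ideal.Quotient.eq_zero_iff_mem.mpr hg, smul_zero]
    exact zero_mem _
  obtain ⟨h, hh⟩ : ∃ h : W, ∀ P, h ∉ p P := by
    by_contra! hcov
    obtain ⟨P, hP⟩ := Subspace.exists_eq_top_of_iUnion_eq_univ (p := p)
      (Set.eq_univ_of_forall fun h => Set.mem_iUnion.mpr (hcov h))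
    exact hp P hP
  refine ⟨h, h.2, fun g hg => ?_⟩
  by_contra hgI
  have hmem : (h : S3) ∈ {a : S3 | ∃ x : S3 ⧸ I, x ≠ 0 ∧ a • x = 0} :=
    ⟨Ideal.Quotient.mk I g, fun h0 => hgI (Ideal.Quotient.eq_zero_iff_mem.mp h0),
      Ideal.Quotient.eq_zero_iff_mem.mpr (show (h : S3) * g ∈ I by rwa [mul_comm])⟩
  rw [← biUnion_associatedPrimes_eq_zero_divisors] at hmem
  obtain ⟨P, hP, hhP⟩ := Set.mem_iUnion₂.mp hmem
  exact hh ⟨P, hP⟩ hhP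

/-- The Hilbert function of the quotient by a saturated ideal is nondecreasing. -/
lemma hilbert_le_succ (hsat : ∀ g, (∀ i, X i * g ∈ I) → g ∈ I) (n : ℕ) :
    finrank ℂ (homogeneousSubmodule (Fin 3) ℂ n) + finrank ℂ (degPart I (n + 1)) ≤
      finrank ℂ (homogeneousSubmodule (Fin 3) ℂ (n + 1)) + finrank ℂ (degPart I n) := by
  obtain ⟨h, hh, hreg⟩ := exists_linear_regular hsat
  let π : S3 →ₗ[ℂ] S3 ⧸ I := I.mkQ.restrictScalars ℂ
  have hker : ∀ m, homogeneousSubmodule (Fin 3) ℂ m ⊓ LinearMap.ker π = degPart I m := fun m => by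
    ext g
    simp [π, mem_degPart, and_comm]
  have hker' : homogeneousSubmodule (Fin 3) ℂ n ⊓
      LinearMap.ker (π ∘ₗ LinearMap.mulRight ℂ h) = degPart I n := by
    ext g
    simp only [π, Submodule.mem_inf, mem_homogeneousSubmodule, LinearMap.mem_ker,
      LinearMap.comp_apply, LinearMap.mulRight_apply, LinearMap.restrictScalars_apply,
      Submodule.mkQ_apply, Submodule.Quotient.mk_eq_zero, mem_degPart]
    exact ⟨fun hg => ⟨hreg g hg.2, hg.1⟩, fun hg => ⟨hg.2, I.mul_mem_right h hg.1⟩⟩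
  have hle : (homogeneousSubmodule (Fin 3) ℂ n).map (π ∘ₗ LinearMap.mulRight ℂ h) ≤
      (homogeneousSubmodule (Fin 3) ℂ (n + 1)).map π := by
    rintro _ ⟨g, hg, rfl⟩
    exact ⟨g * h, IsHomogeneous.mul hg hh, rfl⟩
  have h1 : finrank ℂ ((homogeneousSubmodule (Fin 3) ℂ n).map (π ∘ₗ LinearMap.mulRight ℂ h)) +
      finrank ℂ (degPart I n) = finrank ℂ (homogeneousSubmodule (Fin 3) ℂ n) := by
    rw [← hker']
    exact finrank_map_add_finrank_inf_ker _ _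
  have h2 : finrank ℂ ((homogeneousSubmodule (Fin 3) ℂ (n + 1)).map π) +
      finrank ℂ (degPart I (n + 1)) = finrank ℂ (homogeneousSubmodule (Fin 3) ℂ (n + 1)) := by
    rw [← hker]
    exact finrank_map_add_finrank_inf_ker _ _
  have h3 := Submodule.finrank_mono hle
  omega

lemma hilbert_le_of_le (hsat : ∀ g, (∀ i, X i * g ∈ I) → g ∈ I) {n m : ℕ} (hnm : n ≤ m) :
    finrank ℂ (homogeneousSubmodule (Fin 3) ℂ n) + finrank ℂ (degPart I m) ≤
      finrank ℂ (homogeneousSubmodule (Fin 3) ℂ m) + finrank ℂ (degPart I n) := by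
  induction m, hnm using Nat.le_induction with
  | base => rfl
  | succ m _ ih =>
    have := hilbert_le_succ hsat m
    omega

lemma exists_mem_notMem_of_finrank_lt {V W : Submodule ℂ S3} [FiniteDimensional ℂ W]
    (h : finrank ℂ W < finrank ℂ V) : ∃ g ∈ V, g ∉ W := by
  by_contra! hVW
  exact absurd (Submodule.finrank_mono (show V ≤ W from hVW)) (by omega)

/-- The degree `n + 1` part of the principal ideal of a linear form. -/
lemma finrank_map_mulRight {l : S3} (hl0 : l ≠ 0) (n : ℕ) :
    finrank ℂ ((homogeneousSubmodule (Fin 3) ℂ n).map (LinearMap.mulRight ℂ l)) =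
      finrank ℂ (homogeneousSubmodule (Fin 3) ℂ n) :=
  finrank_map_of_injective _ (mul_left_injective₀ hl0)

lemma not_dvd_of_notMem_map {l q : S3} {n : ℕ} (hl : l.IsHomogeneous 1) (hl0 : l ≠ 0)
    (hqn : q.IsHomogeneous (n + 1))
    (hq : q ∉ (homogeneousSubmodule (Fin 3) ℂ n).map (LinearMap.mulRight ℂ l)) : ¬ l ∣ q := by
  rintro ⟨c, rfl⟩
  exact hq ⟨c, isHomogeneous_of_mul hl hl0 (mul_comm l c ▸ hqn), mul_comm c l⟩

/-- A saturated homogeneous ideal of a zero-dimensional scheme of degree two is generated by a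
linear form and a quadratic form. -/
lemma exists_eq_span_linear_quadratic (hsat : ∀ g, (∀ i, X i * g ∈ I) → g ∈ I)
    (hhom : ∀ g ∈ I, ∀ n, homogeneousComponent n g ∈ I)
    (htwo : ∀ᶠ n in atTop, finrank ℂ (degPart I n) + 2 =
      finrank ℂ (homogeneousSubmodule (Fin 3) ℂ n)) :
    ∃ l q : S3, l.IsHomogeneous 1 ∧ q.IsHomogeneous 2 ∧ Prime l ∧ ¬ l ∣ q ∧
      I = Ideal.span {l, q} := by
  obtain ⟨N, hN⟩ := eventually_atTop.mp htwo
  have hs : ∀ n : ℕ, 2 * (finrank ℂ (homogeneousSubmodule (Fin 3) ℂ n) : ℤ) = (n + 1) * (n + 2) :=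
    two_mul_finrank_homogeneousSubmodule
  have hs0 : finrank ℂ (homogeneousSubmodule (Fin 3) ℂ 0) = 1 := finrank_homogeneousSubmodule 0
  have hs1 : finrank ℂ (homogeneousSubmodule (Fin 3) ℂ 1) = 3 := finrank_homogeneousSubmodule 1
  have hs2 : finrank ℂ (homogeneousSubmodule (Fin 3) ℂ 2) = 6 := finrank_homogeneousSubmodule 2
  have hlower : ∀ n, finrank ℂ (homogeneousSubmodule (Fin 3) ℂ n) ≤
      finrank ℂ (degPart I n) + 2 := fun n => by
    have h1 := hilbert_le_of_le hsat (le_max_left n N)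
    have h2 := hN _ (le_max_right n N)
    omega
  have hI0 : degPart I 0 = ⊥ := by
    rw [eq_bot_iff]
    rintro g ⟨hg, hg0⟩
    rw [Submodule.mem_bot]
    by_contra hne
    replace hg0 : g.IsHomogeneous 0 := hg0
    rw [← totalDegree_zero_iff_isHomogeneous, totalDegree_eq_zero_iff_eq_C] at hg0
    have hunit : IsUnit g := by
      rw [hg0]
      exact (isUnit_iff_ne_zero.mpr fun h => hne (by rw [hg0, h, C_0])).map C
    have htop : I = ⊤ := I.eq_top_of_isUnit_mem hg hunit
    have hfull : finrank ℂ (homogeneousSubmodule (Fin 3) ℂ N) ≤ finrank ℂ (degPart I N) :=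
      Submodule.finrank_mono fun a ha => mem_degPart.mpr ⟨htop ▸ Submodule.mem_top, ha⟩
    have := hN N le_rfl
    omega
  have hi0 : finrank ℂ (degPart I 0) = 0 := by rw [hI0, finrank_bot]
  have hi1 : finrank ℂ (degPart I 1) ≤ 2 := by
    have := hilbert_le_of_le hsat (Nat.zero_le 1)
    omega
  have hi1' := hlower 1
  obtain ⟨l, ⟨hlI, hl⟩, hl0⟩ := exists_mem_notMem_of_finrank_lt
    (V := degPart I 1) (W := ⊥) (by rw [finrank_bot]; omega)
  replace hl : l.IsHomogeneous 1 := hl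
  rw [Submodule.mem_bot] at hl0
  have hlp := prime_of_isHomogeneous_one hl hl0
  have hi1 : finrank ℂ (degPart I 1) = 1 := by
    by_contra hne
    obtain ⟨q, ⟨hqI, hq⟩, hqn⟩ := exists_mem_notMem_of_finrank_lt (V := degPart I 1)
      (W := (homogeneousSubmodule (Fin 3) ℂ 0).map (LinearMap.mulRight ℂ l))
      (by rw [finrank_map_mulRight hl0]; omega)
    have h1 := finrank_degPart_span_pair hlp (not_dvd_of_notMem_map hl hl0 hq hqn) hl hq N
    have h2 := Submodule.finrank_mono (degPart_mono (I := Ideal.span {l, q}) (J := I)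
      (Ideal.span_le.mpr (Set.pair_subset hlI hqI)) (N + 1 + 1))
    have h3 := hN (N + 1 + 1) (by omega)
    have e1 := hs N
    have e2 := hs (N + 1)
    have e3 := hs (N + 1 + 1)
    push_cast at e1 e2 e3
    ring_nf at e1 e2 e3
    omega
  have hupper : ∀ n, 1 ≤ n → finrank ℂ (degPart I n) + 2 ≤
      finrank ℂ (homogeneousSubmodule (Fin 3) ℂ n) := fun n hn => by
    have := hilbert_le_of_le hsat hn
    omega
  obtain ⟨q, ⟨hqI, hq⟩, hqn⟩ := exists_mem_notMem_of_finrank_lt (V := degPart I 2)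
    (W := (homogeneousSubmodule (Fin 3) ℂ 1).map (LinearMap.mulRight ℂ l))
    (by rw [finrank_map_mulRight hl0]; have := hlower 2; omega)
  have hlq := not_dvd_of_notMem_map hl hl0 hq hqn
  have hle : Ideal.span {l, q} ≤ I := Ideal.span_le.mpr (Set.pair_subset hlI hqI)
  have hlmem : l ∈ Ideal.span {l, q} := Ideal.subset_span (by simp)
  have hqmem : q ∈ Ideal.span {l, q} := Ideal.subset_span (by simp)
  have hspan : ∀ n, 1 ≤ n → finrank ℂ (homogeneousSubmodule (Fin 3) ℂ n) ≤
      finrank ℂ (degPart (Ideal.span {l, q}) n) + 2 := by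
    rintro (_ | _ | _ | n) hn
    · omega
    · have : degPart (Ideal.span {l, q}) 1 ≠ ⊥ := fun h =>
        hl0 ((Submodule.mem_bot ℂ).mp (h ▸ mem_degPart.mpr ⟨hlmem, hl⟩))
      have := Submodule.one_le_finrank_iff.mpr this
      rw [Nat.zero_add]
      omega
    · have hlt : (homogeneousSubmodule (Fin 3) ℂ 1).map (LinearMap.mulRight ℂ l) <
          degPart (Ideal.span {l, q}) 2 := by
        refine lt_of_le_of_ne ?_ fun h => hqn (h ▸ mem_degPart.mpr ⟨hqmem, hq⟩)
        rintro _ ⟨c, hc, rfl⟩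
        exact ⟨Ideal.mul_mem_left _ c hlmem, IsHomogeneous.mul hc hl⟩
      have := Submodule.finrank_lt_finrank_of_lt hlt
      rw [finrank_map_mulRight hl0] at this
      simp only [Nat.reduceAdd]
      omega
    · have h1 := finrank_degPart_span_pair hlp hlq hl hq n
      have e1 := hs n
      have e2 := hs (n + 1)
      have e3 := hs (n + 2)
      have e4 := hs (n + 3)
      push_cast at e1 e2 e3 e4
      rw [show n + 1 + 2 = n + 3 by omega] at h1
      rw [show n + 1 + 1 + 1 = n + 3 by omega]
      ring_nf at e1 e2 e3 e4 h1 ⊢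
      omega
  refine ⟨l, q, hl, hq, hlp, hlq, le_antisymm (fun g hg => ?_) hle⟩
  rw [← sum_homogeneousComponent g]
  refine Ideal.sum_mem _ fun n _ => ?_
  have hmem : homogeneousComponent n g ∈ degPart I n :=
    mem_degPart.mpr ⟨hhom g hg n, homogeneousComponent_isHomogeneous n g⟩
  rcases Nat.eq_zero_or_pos n with rfl | hn
  · rw [hI0, Submodule.mem_bot] at hmem
    rw [hmem]
    exact zero_mem _
  · have heq := Submodule.eq_of_le_of_finrank_le (degPart_mono hle n)
      (by have := hupper n hn; have := hspan n hn; omega)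
    rw [← heq] at hmem
    exact hmem.1

end Saturated

end PlaneCurve

namespace PlaneCurve

open Module Filter Matrix

variable {f : S3} {d r τ : ℕ}

lemma jacobianIdeal_eq_span_range_grad (f : S3) :
    jacobianIdeal f = Ideal.span (Set.range (grad f)) := by
  rw [jacobianIdeal]
  congr 1
  ext g
  simp [grad, Fin.exists_fin_succ, eq_comm]

/-- A syzygy of minimal degree and the gradient of a reduced curve form a syzygy pair. -/
lemma isSyzPair_of_minimal_degree {u : Fin 3 → S3} (hd : d ≠ 0) (hf : f.IsHomogeneous d)
    (hred : Squarefree f) (hu : u ∈ jacSyz f) (hu0 : u ≠ 0) (hur : ∀ i, (u i).IsHomogeneous r)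
    (hmin : ∀ m, m < r → ∀ v ∈ jacSyz f, (∀ i, (v i).IsHomogeneous m) → v = 0) :
    IsSyzPair u (grad f) r (d - 1) where
  hom_left := hur
  hom_right _ := hf.pderiv
  dot_eq_zero := mem_jacSyz_iff.mp hu
  primitive_left := isPrimitive_of_minimal_degree hf hu hu0 hur hmin
  primitive_right := grad_isPrimitive hd hf hred

/-- The Hilbert polynomial of `crossIdeal u (grad f)` in terms of the total Tjurina number. -/
lemma IsSyzPair.eventually_finrank_degPart {u : Fin 3 → S3} (hd : d ≠ 0)
    (h : IsSyzPair u (grad f) r (d - 1)) (htau : IsTjurina f τ) :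
    ∀ᶠ n in atTop, (finrank ℂ (degPart (crossIdeal u (grad f)) n) : ℤ) +
      (((d : ℤ) - 1) ^ 2 - r * ((d : ℤ) - r - 1) - τ) =
        finrank ℂ (homogeneousSubmodule (Fin 3) ℂ n) := by
  obtain ⟨K, hK⟩ := eventually_atTop.mp htau
  filter_upwards [eventually_ge_atTop (K + 2 * r)] with n hn
  obtain ⟨t, rfl⟩ : ∃ t, n = t + 2 * r := ⟨n - 2 * r, by omega⟩
  obtain ⟨e, rfl⟩ : ∃ e, d = e + 1 := ⟨d - 1, by omega⟩
  rw [Nat.add_sub_cancel] at h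
  have h1 := milnorDim_add_finrank_degPart f (t + e + r + e)
  rw [hK _ (by omega), jacobianIdeal_eq_span_range_grad] at h1
  have h2 := finrank_degPart_span_add h.hom_right (t + e + r)
  have h3 := h.finrank_syzPart (n := t + 2 * r) (m := t + e) (by omega)
  have e1 := two_mul_finrank_homogeneousSubmodule (t + e + r + e)
  have e2 := two_mul_finrank_homogeneousSubmodule (t + e + r)
  have e3 := two_mul_finrank_homogeneousSubmodule (t + 2 * r)
  have e4 := two_mul_finrank_homogeneousSubmodule (t + e)
  zify at h1 h2 h3
  push_cast at e1 e2 e3 e4 ⊢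
  refine mul_left_cancel₀ (two_ne_zero (α := ℤ)) ?_
  linear_combination 2 * h2 - 2 * h1 - 2 * h3 - e1 + 3 * e2 - e3 - e4

lemma vecComponent_eq_zero_of_mem_span {m n : ℕ} {dd : Fin m → ℕ} {v : Fin m → Fin 3 → S3}
    (hv : ∀ j i, (v j i).IsHomogeneous (dd j)) (hn : ∀ j, n < dd j) {x : Fin 3 → S3}
    (hx : x ∈ Submodule.span S3 (Set.range v)) : vecComponent n x = 0 := by
  obtain ⟨c, rfl⟩ := (Submodule.mem_span_range_iff_exists_fun S3).mp hx
  ext1 i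
  simp only [vecComponent, Finset.sum_apply, map_sum]
  exact Finset.sum_eq_zero fun j _ => congrFun (vecComponent_smul_of_lt (hv j) (hn j) (c j)) i

/-- The lowest exponent is the minimal degree of a Jacobian syzygy. -/
lemma exponent_zero_eq_of_isMDR {m : ℕ} {dd : Fin (m + 1) → ℕ} {v : Fin (m + 1) → Fin 3 → S3}
    (h : IsMinGenSyz f (m + 1) dd v) (hmdr : IsMDR f r) : dd 0 = r := by
  obtain ⟨⟨u, hu, hu0, hur⟩, hmin⟩ := hmdr
  rcases lt_trichotomy (dd 0) r with hlt | heq | hlt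
  · exact absurd (hmin _ hlt _ (h.mem 0) (h.hom 0)) (h.ne_zero 0)
  · exact heq
  · rw [← h.span_eq] at hu
    have := vecComponent_eq_zero_of_mem_span h.hom
      (fun j => hlt.trans_le (h.mono (Fin.zero_le j))) hu
    exact absurd (vecComponent_eq_self hur ▸ this) hu0

lemma cross_sub_smul_eq_zero {u v v' w : Fin 3 → S3} {g g' c : S3} (hv : u ⨯₃ v = g • w)
    (hv' : u ⨯₃ v' = g' • w) (hg : g' = g * c) : u ⨯₃ (v' - c • v) = 0 := by
  rw [map_sub, map_smul, hv, hv', hg, smul_smul, mul_comm, sub_self]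

/-- The cross ideal of a curve with three generating syzygies is a complete intersection. -/
lemma exists_crossIdeal_eq_span_pair {e d1 d2 d3 a b : ℕ}
    {v : Fin 3 → Fin 3 → S3} (h : IsSyzPair (v 0) (grad f) d1 e)
    (hv : IsMinGenSyz f 3 ![d1, d2, d3] v) (ha : a + e = d1 + d2) (hb : b + e = d1 + d3) :
    ∃ l q : S3, l.IsHomogeneous a ∧ q.IsHomogeneous b ∧ l ≠ 0 ∧ ¬ l ∣ q ∧
      crossIdeal (v 0) (grad f) = Ideal.span {l, q} := by
  have hmem : ∀ j k, j ≠ k → v j ∈ Submodule.span S3 (v '' {j' | j' ≠ k}) := fun j k hjk =>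
    Submodule.subset_span ⟨j, hjk, rfl⟩
  obtain ⟨l, hl⟩ := h.exists_cross_eq (mem_jacSyz_iff.mp (hv.mem 1))
  obtain ⟨q, hq⟩ := h.exists_cross_eq (mem_jacSyz_iff.mp (hv.mem 2))
  refine ⟨l, q, h.isHomogeneous_of_cross (hv.hom 1) hl ha,
    h.isHomogeneous_of_cross (hv.hom 2) hq hb, ?_, ?_, ?_⟩
  · rintro rfl
    obtain ⟨c, hc⟩ := h.primitive_left.2 (v 1) (by rw [hl, zero_smul])
    exact hv.minimal 1 (hc ▸ Submodule.smul_mem _ c (hmem 0 1 (by decide)))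
  · rintro ⟨c, hc⟩
    obtain ⟨c', hc'⟩ := h.primitive_left.2 _ (cross_sub_smul_eq_zero hl hq hc)
    rw [sub_eq_iff_eq_add] at hc'
    apply hv.minimal 2
    rw [hc']
    exact add_mem (Submodule.smul_mem _ _ (hmem 0 2 (by decide)))
      (Submodule.smul_mem _ _ (hmem 1 2 (by decide)))
  · refine le_antisymm (fun g hg => ?_) (Ideal.span_le.mpr (Set.pair_subset ⟨_, hl⟩ ⟨_, hq⟩))
    obtain ⟨x, hx⟩ := mem_crossIdeal_iff.mp hg
    rcases eq_or_ne g 0 with rfl | hg0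
    · exact zero_mem _
    have hxmem : x ∈ jacSyz f := mem_jacSyz_iff.mpr (dot_eq_zero_of_cross hx hg0)
    rw [← hv.span_eq, Submodule.mem_span_range_iff_exists_fun] at hxmem
    obtain ⟨c, rfl⟩ := hxmem
    rw [Fin.sum_univ_three] at hx
    simp only [map_add, map_smul, hl, hq, cross_self, smul_zero, zero_add, smul_smul,
      ← add_smul] at hx
    rw [Ideal.mem_span_pair]
    exact ⟨c 1, c 2, h.primitive_right.smul_injective hx⟩

/-- A vector of forms of too small a degree is no combination of two vectors subject to the
Koszul relation of `l` and `q`. -/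
lemma eq_zero_of_smul_add_smul_of_koszul {u v v' : Fin 3 → S3} {b c l q : S3} {a a' k k' : ℕ}
    (hl : Prime l) (hlq : ¬ l ∣ q) (hla : l.IsHomogeneous a) (hqa : q.IsHomogeneous a')
    (hu : ∀ i, (u i).IsHomogeneous r) (hv : ∀ i, (v i).IsHomogeneous k)
    (hv' : ∀ i, (v' i).IsHomogeneous k') (hk : a + k' = a' + k) (hr : r < a + k')
    (hrel : b * l + c * q = 0) (huv : b • v + c • v' = u) : u = 0 := by
  obtain ⟨g, rfl⟩ : l ∣ c :=
    (hl.dvd_or_dvd ⟨-b, by linear_combination hrel⟩).resolve_right hlq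
  have hb : b = -(g * q) := mul_right_cancel₀ hl.ne_zero (by linear_combination hrel)
  ext1 i
  have hui : u i = g * (l * v' i - q * v i) := by
    rw [← huv, hb, Pi.add_apply, Pi.smul_apply, Pi.smul_apply, smul_eq_mul, smul_eq_mul]
    ring
  have hdeg : (l * v' i - q * v i).IsHomogeneous (a + k') :=
    (hla.mul (hv' i)).sub (hk ▸ hqa.mul (hv i))
  have := hu i
  rw [hui] at this ⊢
  exact eq_zero_of_mul_of_lt hdeg this hr

/-- Lifting generators of the cross ideal gives minimal generators of the syzygy module. -/
lemma isMinGenSyz_of_crossIdeal_eq_span_pair {u v v' : Fin 3 → S3} {l q : S3} {e k : ℕ}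
    (h : IsSyzPair u (grad f) r e) (hl : Prime l) (hlq : ¬ l ∣ q)
    (hspan : crossIdeal u (grad f) = Ideal.span {l, q})
    (hl1 : l.IsHomogeneous 1) (hq2 : q.IsHomogeneous 2)
    (hv : ∀ i, (v i).IsHomogeneous k) (hv' : ∀ i, (v' i).IsHomogeneous (k + 1))
    (hvf : v ∈ jacSyz f) (hvf' : v' ∈ jacSyz f)
    (hlv : u ⨯₃ v = l • grad f) (hqv : u ⨯₃ v' = q • grad f) (hrk : r ≤ k) :
    IsMinGenSyz f 3 ![r, k, k + 1] ![u, v, v'] := by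
  have huf : u ∈ jacSyz f := mem_jacSyz_iff.mpr h.dot_eq_zero
  have hinj := h.primitive_right.smul_injective
  have hq0 : q ≠ 0 := fun h0 => hlq (h0 ▸ dvd_zero l)
  have hcross : ∀ b c : S3, u ⨯₃ (b • v + c • v') = (b * l + c * q) • grad f := fun b c => by
    rw [map_add, map_smul, map_smul, hlv, hqv, smul_smul, smul_smul, add_smul]
  have hmin : ∀ (j : Fin 3) (c : Fin 3 → S3), c j = 0 →
      c 0 • u + (c 1 • v + c 2 • v') ≠ ![u, v, v'] j := fun j c hcj hc => by
    have key : u ⨯₃ ![u, v, v'] j = (c 1 * l + c 2 * q) • grad f := by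
      rw [← hc, map_add, map_smul, cross_self, smul_zero, zero_add, hcross]
    fin_cases j <;> dsimp at hcj hc key
    · have hrel : c 1 * l + c 2 * q = 0 := hinj (by simpa using key.symm)
      refine h.primitive_left.1 (eq_zero_of_smul_add_smul_of_koszul hl hlq hl1 hq2 h.hom_left hv hv'
        (by omega) (by omega) hrel ?_)
      rwa [hcj, zero_smul, zero_add] at hc
    · rw [hlv, hcj, zero_mul, zero_add] at key
      have hrel : l = c 2 * q := hinj key
      exact hl.ne_zero (hrel.trans (eq_zero_of_mul_of_lt hq2 (hrel ▸ hl1) one_lt_two))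
    · rw [hqv, hcj, zero_mul, add_zero] at key
      exact hlq ⟨c 1, (hinj key).trans (mul_comm _ _)⟩
  have hmem : ∀ j, ![u, v, v'] j ∈ jacSyz f := fun j => by
    fin_cases j
    exacts [huf, hvf, hvf']
  refine ⟨hmem, ?_, ?_, ?_, ?_, ?_⟩
  · intro j
    fin_cases j
    exacts [h.hom_left, hv, hv']
  · intro j hj
    exact hmin j 0 rfl (by simpa using hj.symm)
  · refine le_antisymm (Submodule.span_le.mpr (Set.range_subset_iff.mpr hmem)) fun x hx => ?_
    obtain ⟨g, hg⟩ := h.exists_cross_eq (mem_jacSyz_iff.mp hx)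
    have hgI : g ∈ crossIdeal u (grad f) := ⟨x, hg⟩
    rw [hspan, Ideal.mem_span_pair] at hgI
    obtain ⟨b, c, rfl⟩ := hgI
    obtain ⟨a, ha⟩ := h.primitive_left.2 (x - (b • v + c • v')) (by
      rw [map_sub, hg, hcross, sub_self])
    rw [sub_eq_iff_eq_add, ← add_assoc] at ha
    rw [Submodule.mem_span_range_iff_exists_fun]
    exact ⟨![a, b, c], by rw [Fin.sum_univ_three, ha]; rfl⟩
  · intro j hj
    rw [Finsupp.mem_span_image_iff_linearCombination] at hj
    obtain ⟨c, hcs, hc⟩ := hj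
    rw [Finsupp.mem_supported'] at hcs
    refine hmin j c (hcs j (by simp)) ?_
    rw [← hc, Finsupp.linearCombination_apply, Finsupp.sum_fintype _ _ (by simp), Fin.sum_univ_three,
      ← add_assoc]
    rfl
  · rw [Fin.monotone_iff_le_succ]
    intro i
    fin_cases i
    exacts [hrk, k.le_succ]

theorem isMPOG_iff (hd : d ≠ 0) (hf : f.IsHomogeneous d) (hred : Squarefree f)
    (hmdr : IsMDR f r) (htau : IsTjurina f τ) :
    IsMPOG f d ↔ (τ : ℤ) = ((d : ℤ) - 1) ^ 2 - r * ((d : ℤ) - r - 1) - 2 := by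
  constructor
  · rintro ⟨d1, d2, hd12, v, hv⟩
    obtain rfl : d1 = r := exponent_zero_eq_of_isMDR hv hmdr
    have h : IsSyzPair (v 0) (grad f) d1 (d - 1) :=
      isSyzPair_of_minimal_degree hd hf hred (hv.mem 0) (hv.ne_zero 0) (hv.hom 0) hmdr.2
    obtain ⟨l, q, hl, hq, hl0, hlq, hI⟩ :=
      exists_crossIdeal_eq_span_pair (a := 1) (b := 2) h hv (by omega) (by omega)
    obtain ⟨K, hK⟩ := eventually_atTop.mp (h.eventually_finrank_degPart hd htau)
    have h1 := hK (K + 1 + 2) (by omega)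
    have h2 := finrank_degPart_span_pair (prime_of_isHomogeneous_one hl hl0) hlq hl hq K
    rw [hI] at h1
    have e1 := two_mul_finrank_homogeneousSubmodule K
    have e2 := two_mul_finrank_homogeneousSubmodule (K + 1)
    have e3 := two_mul_finrank_homogeneousSubmodule (K + 2)
    have e4 := two_mul_finrank_homogeneousSubmodule (K + 1 + 2)
    zify at h2
    push_cast at e1 e2 e3 e4
    refine mul_left_cancel₀ (two_ne_zero (α := ℤ)) ?_
    linear_combination -2 * h1 + 2 * h2 - e1 + e2 + e3 - e4
  · intro hτ
    obtain ⟨⟨u, hu, hu0, hur⟩, hmin⟩ := hmdr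
    have h := isSyzPair_of_minimal_degree hd hf hred hu hu0 hur hmin
    obtain ⟨l, q, hl, hq, hlp, hlq, hI⟩ := exists_eq_span_linear_quadratic
      (fun g => mem_crossIdeal_of_forall_X_mul_mem h.primitive_left)
      (fun g hg => h.homogeneousComponent_mem hg) (by
        filter_upwards [h.eventually_finrank_degPart hd htau] with n hn
        rw [hτ] at hn
        zify
        linear_combination hn)
    have hq0 : q ≠ 0 := fun h0 => hlq (h0 ▸ dvd_zero l)
    obtain ⟨k, hk, v, hv, hvw, hlv⟩ := h.exists_homogeneous_of_mem
      (hI ▸ Ideal.subset_span (by simp)) hl hlp.ne_zero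
    obtain ⟨k', hk', v', hv', hvw', hqv⟩ := h.exists_homogeneous_of_mem
      (hI ▸ Ideal.subset_span (by simp)) hq hq0
    obtain rfl : k' = k + 1 := by omega
    have hrk : r ≤ k := by
      by_contra hlt
      rw [hmin k (by omega) v (mem_jacSyz_iff.mpr hvw) hv, map_zero] at hlv
      exact hlp.ne_zero (h.primitive_right.smul_injective (by simpa using hlv.symm))
    exact ⟨r, k, by omega, ![u, v, v'], isMinGenSyz_of_crossIdeal_eq_span_pair h hlp hlq hI hl hq
      hv hv' (mem_jacSyz_iff.mpr hvw) (mem_jacSyz_iff.mpr hvw') hlv hqv hrk⟩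

end PlaneCurve

/-- A reduced plane curve `C : f = 0` of degree `d ≥ 3` (not the union of `d` lines through
one point) with `r = mdr(f)` is a minimal plus-one generated (MPOG) curve if and only if
`τ(C) = (d-1)² - r(d-r-1) - 2`. -/
theorem statement3 (f : S3) (d r τ : ℕ) (hd : 3 ≤ d)
    (hhom : f.IsHomogeneous d) (hred : Squarefree f)
    (hlines : ¬ IsUnionOfConcurrentLines f d)
    (hmdr : IsMDR f r) (htau : IsTjurina f τ) :
    IsMPOG f d ↔ (τ : ℤ) = ((d : ℤ) - 1) ^ 2 - r * ((d : ℤ) - r - 1) - 2 := by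
  exact PlaneCurve.isMPOG_iff (by omega) hhom hred hmdr htau

end
end

section
/- The polynomials g and g' in ℂ[x,y] have no critical points: the ideal (g_x, g_y) generated by the two partial derivatives of g is the unit ideal of ℂ[x,y], and likewise the ideal (g'_x, g'_y) is the unit ideal. In particular, all the fibers g⁻¹(t) and g'⁻¹(t), t ∈ ℂ, are smooth affine plane curves. -/
open MvPolynomial

noncomputable section

/-- `R = ℂ[x,y]`, with `x = X 0`, `y = X 1`. -/
abbrev R2 := MvPolynomial (Fin 2) ℂ

/-- `s = xy + 1`. -/
def sB : R2 := X 0 * X 1 + 1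

/-- `p = xs + 1`. -/
def pB : R2 := X 0 * sB + 1

/-- `u = s² + y`. -/
def uB : R2 := sB ^ 2 + X 1

/-- The Briançon polynomial `g = p²u - (5/3)ps - (1/3)s`. -/
def gB : R2 := pB ^ 2 * uB - C (5 / 3 : ℂ) * pB * sB - C (1 / 3 : ℂ) * sB

/-- The Briançon-type polynomial `g' = p²u - (7/9)ps + (1/9)s`. -/
def gB' : R2 := pB ^ 2 * uB - C (7 / 9 : ℂ) * pB * sB + C (1 / 9 : ℂ) * sB

/-- Partial derivative in `x` of a combination of `p²u`, `ps` and `s`. -/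
lemma pderiv_zero_combination (a b : ℂ) :
    pderiv 0 (pB ^ 2 * uB - C a * pB * sB + C b * sB) =
      2 * pB * (sB + X 0 * X 1) * uB + 2 * pB ^ 2 * sB * X 1
        - C a * ((sB + X 0 * X 1) * sB + pB * X 1) + C b * X 1 := by
  simp only [pB, uB, sB, map_add, map_sub, Derivation.leibniz, Derivation.leibniz_pow,
    pderiv_X_self, pderiv_X_of_ne (show (1 : Fin 2) ≠ 0 by decide), pderiv_C, pderiv_one,
    smul_eq_mul, nsmul_eq_mul]
  push_cast
  ring

/-- Partial derivative in `y` of a combination of `p²u`, `ps` and `s`. -/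
lemma pderiv_one_combination (a b : ℂ) :
    pderiv 1 (pB ^ 2 * uB - C a * pB * sB + C b * sB) =
      2 * pB * X 0 ^ 2 * uB + pB ^ 2 * (2 * sB * X 0 + 1)
        - C a * (X 0 ^ 2 * sB + pB * X 0) + C b * X 0 := by
  simp only [pB, uB, sB, map_add, map_sub, Derivation.leibniz, Derivation.leibniz_pow,
    pderiv_X_self, pderiv_X_of_ne (show (0 : Fin 2) ≠ 1 by decide), pderiv_C, pderiv_one,
    smul_eq_mul, nsmul_eq_mul]
  push_cast
  ring

lemma gB_eq_combination :
    gB = pB ^ 2 * uB - C (5 / 3 : ℂ) * pB * sB + C (-1 / 3 : ℂ) * sB := by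
  rw [gB, neg_div, C_neg]
  ring

/-- Clearing denominators in a scalar of `ℂ[x,y]`. -/
lemma natCast_mul_C {n : ℕ} {m : ℤ} {a : ℂ} (h : n * a = m) : (n : R2) * C a = (m : R2) := by
  rw [← map_natCast (C : ℂ →+* R2), ← map_intCast (C : ℂ →+* R2), ← C_mul, h]

/-- An ideal of `ℂ[x,y]` generated by two elements is the unit ideal as soon as a combination of
them is a nonzero integer. -/
lemma span_pair_eq_top_of_combination {f₁ f₂ : R2} (n : ℕ) (hn : n ≠ 0) (a b : R2)
    (h : a * f₁ + b * f₂ = n) : Ideal.span {f₁, f₂} = ⊤ := by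
  refine Ideal.eq_top_of_isUnit_mem _ (Ideal.mem_span_pair.2 ⟨a, b, h⟩) ?_
  rw [← map_natCast (C : ℂ →+* R2)]
  exact (IsUnit.mk0 (n : ℂ) (Nat.cast_ne_zero.2 hn)).map C

/-- Generators of the unit ideal have no common zero. -/
lemma not_eval_eq_zero_of_span_pair_eq_top {f₁ f₂ : R2} (h : Ideal.span {f₁, f₂} = ⊤)
    (P : Fin 2 → ℂ) : ¬ (eval P f₁ = 0 ∧ eval P f₂ = 0) := by
  rintro ⟨h₁, h₂⟩
  obtain ⟨a, b, hab⟩ := Ideal.mem_span_pair.1 ((Ideal.eq_top_iff_one _).1 h)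
  simpa [h₁, h₂] using congrArg (eval P) hab

lemma span_pderiv_gB : Ideal.span {pderiv 0 gB, pderiv 1 gB} = (⊤ : Ideal R2) := by
  have hc : (3 : R2) * C (5 / 3 : ℂ) = 5 := by
    simpa using natCast_mul_C (n := 3) (m := 5) (a := 5 / 3) (by norm_num)
  have hd : (3 : R2) * C (-1 / 3 : ℂ) = -1 := by
    simpa using natCast_mul_C (n := 3) (m := -1) (a := -1 / 3) (by norm_num)
  set x : R2 := X 0
  set y : R2 := X 1
  let s : R2 := x * y + 1
  let p : R2 := x * s + 1
  let a : R2 := 4 * x ^ 4 * y + 4 * x ^ 3 + x ^ 2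
  let b : R2 := -6 * x ^ 3 * y ^ 2 - 8 * x ^ 2 * y - 2 * x + 1
  refine span_pair_eq_top_of_combination 3 (by norm_num) (3 * a) (3 * b) ?_
  rw [gB_eq_combination, pderiv_zero_combination, pderiv_one_combination]
  simp only [uB, pB, sB]
  push_cast
  linear_combination
    -(a * ((s + x * y) * s + p * y) + b * (x ^ 2 * s + p * x)) * hc + (a * y + b * x) * hd

lemma span_pderiv_gB' : Ideal.span {pderiv 0 gB', pderiv 1 gB'} = (⊤ : Ideal R2) := by
  have hc : (9 : R2) * C (7 / 9 : ℂ) = 7 := by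
    simpa using natCast_mul_C (n := 9) (m := 7) (a := 7 / 9) (by norm_num)
  have hd : (9 : R2) * C (1 / 9 : ℂ) = 1 := by
    simpa using natCast_mul_C (n := 9) (m := 1) (a := 1 / 9) (by norm_num)
  set x : R2 := X 0
  set y : R2 := X 1
  let s : R2 := x * y + 1
  let p : R2 := x * s + 1
  let a : R2 := -144 * x ^ 6 * y ^ 2 - 288 * x ^ 5 * y - 216 * x ^ 4 * y - 144 * x ^ 4
    - 88 * x ^ 3 - 45 * x ^ 2
  let b : R2 := 216 * x ^ 5 * y ^ 3 + 504 * x ^ 4 * y ^ 2 + 270 * x ^ 3 * y ^ 2 + 360 * x ^ 3 * y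
    + 132 * x ^ 2 * y + 72 * x ^ 2 - 10 * x + 3
  refine span_pair_eq_top_of_combination 27 (by norm_num) (9 * a) (9 * b) ?_
  rw [gB', pderiv_zero_combination, pderiv_one_combination]
  simp only [uB, pB, sB]
  push_cast
  linear_combination
    -(a * ((s + x * y) * s + p * y) + b * (x ^ 2 * s + p * x)) * hc + (a * y + b * x) * hd

/-- The polynomials `g` and `g'` have no critical points: their partial derivatives generate
the unit ideal of `ℂ[x,y]`; in particular every fiber `g⁻¹(t)`, `g'⁻¹(t)` is a smooth
affine plane curve. -/
theorem statement4 :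
    (Ideal.span {pderiv 0 gB, pderiv 1 gB} = (⊤ : Ideal R2)) ∧
    (Ideal.span {pderiv 0 gB', pderiv 1 gB'} = (⊤ : Ideal R2)) ∧
    (∀ t : ℂ, ∀ P : Fin 2 → ℂ, eval P gB = t →
      ¬ (eval P (pderiv 0 gB) = 0 ∧ eval P (pderiv 1 gB) = 0)) ∧
    (∀ t : ℂ, ∀ P : Fin 2 → ℂ, eval P gB' = t →
      ¬ (eval P (pderiv 0 gB') = 0 ∧ eval P (pderiv 1 gB') = 0)) := by
  exact ⟨span_pderiv_gB, span_pderiv_gB',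
    fun _ P _ => not_eval_eq_zero_of_span_pair_eq_top span_pderiv_gB P,
    fun _ P _ => not_eval_eq_zero_of_span_pair_eq_top span_pderiv_gB' P⟩

end
end

section
/- In ℂ[x,y] the following two identities hold: (4x⁴y + 4x³ + x²)·g_x − (6x³y² + 8x²y + 2x − 1)·g_y = 1, and −(48x⁶y² + 96x⁵y + 72x⁴y + 48x⁴ + (88/3)x³ + 15x²)·g'_x + (72x⁵y³ + 168x⁴y² + 90x³y² + 120x³y + 44x²y + 24x² − (10/3)x + 1)·g'_y = 1, where g_x, g_y (resp. g'_x, g'_y) denote the partial derivatives of g (resp. g'). -/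
open MvPolynomial

noncomputable section

/-- A constant `n / 9` of `ℂ[x,y]` is the integer `n` times the constant `1 / 9`. -/
lemma C_eq_intCast_mul_C_ninth {c : ℂ} (n : ℤ) (h : c = n * (1 / 9)) :
    (C c : R2) = (n : R2) * C (1 / 9 : ℂ) := by
  rw [h, C_mul, map_intCast]

/-- Two explicit Bezout identities showing that `g` and `g'` have no critical points. -/
theorem statement5 :
    (4 * X 0 ^ 4 * X 1 + 4 * X 0 ^ 3 + X 0 ^ 2) * pderiv 0 gB -
        (6 * X 0 ^ 3 * X 1 ^ 2 + 8 * X 0 ^ 2 * X 1 + 2 * X 0 - 1) * pderiv 1 gB = 1 ∧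
    -(48 * X 0 ^ 6 * X 1 ^ 2 + 96 * X 0 ^ 5 * X 1 + 72 * X 0 ^ 4 * X 1 + 48 * X 0 ^ 4 +
          C (88 / 3 : ℂ) * X 0 ^ 3 + 15 * X 0 ^ 2) * pderiv 0 gB' +
        (72 * X 0 ^ 5 * X 1 ^ 3 + 168 * X 0 ^ 4 * X 1 ^ 2 + 90 * X 0 ^ 3 * X 1 ^ 2 +
          120 * X 0 ^ 3 * X 1 + 44 * X 0 ^ 2 * X 1 + 24 * X 0 ^ 2 - C (10 / 3 : ℂ) * X 0 + 1) *
          pderiv 1 gB' = 1 := by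
  have h9 : 9 * C (1 / 9 : ℂ) = (1 : R2) := by
    rw [← map_ofNat (C : ℂ →+* R2) 9, ← C_mul]
    norm_num
  have h53 := C_eq_intCast_mul_C_ninth (c := 5 / 3) 15 (by norm_num)
  have h13 := C_eq_intCast_mul_C_ninth (c := 1 / 3) 3 (by norm_num)
  have h79 := C_eq_intCast_mul_C_ninth (c := 7 / 9) 7 (by norm_num)
  have h883 := C_eq_intCast_mul_C_ninth (c := 88 / 3) 264 (by norm_num)
  have h103 := C_eq_intCast_mul_C_ninth (c := 10 / 3) 30 (by norm_num)
  simp only [gB, gB', pB, uB, sB, map_add, map_sub, Derivation.leibniz, Derivation.leibniz_pow,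
    pderiv_C, pderiv_one, pderiv_X_self, pderiv_X_of_ne (show (0 : Fin 2) ≠ 1 by decide),
    pderiv_X_of_ne (show (1 : Fin 2) ≠ 0 by decide), smul_eq_mul, nsmul_eq_mul]
  rw [h53, h13, h79, h883, h103]
  push_cast
  generalize (C (1 / 9 : ℂ) : R2) = c at h9 ⊢
  generalize (X 0 : R2) = x
  generalize (X 1 : R2) = y
  constructor
  · grind
  · grind

end
end

section
/- For every t ∈ ℂ, the polynomials g − t and g' − t are irreducible in ℂ[x,y]; that is, all the fibers of the polynomial maps g, g' : ℂ² → ℂ are irreducible affine plane curves. -/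
open MvPolynomial

noncomputable section

/-- If `σ : B → A` becomes surjective after inverting `d`, a prime `F` of `B` whose image is
`e * G`, with `e` dividing `σ d` and `G` a nonunit cancellable against `σ d`, yields a prime `G`
of `A`. -/
theorem prime_of_localization {A B : Type*} [CommRing A] [CommRing B] [IsDomain A]
    (σ : B →+* A) (hσ : Function.Injective σ) (d : B)
    (hd : ∀ a : A, ∃ (n : ℕ) (b : B), σ b = σ d ^ n * a)
    {F : B} (hF : Prime F) {G e : A} (he : e ∣ σ d) (hFG : σ F = e * G)
    (hG_unit : ¬ IsUnit G) (hG : ∀ k, G ∣ σ d * k → G ∣ k) : Prime G := by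
  have ascend : ∀ b, F ∣ b → G ∣ σ b := fun b h =>
    (Dvd.intro_left e hFG.symm).trans (map_dvd σ h)
  have hFd : ¬ F ∣ d := fun h =>
    hG_unit (isUnit_of_dvd_one (hG 1 (by rw [mul_one]; exact ascend d h)))
  have hGpow : ∀ (n : ℕ) k, G ∣ σ d ^ n * k → G ∣ k := by
    intro n
    induction n with
    | zero => intro k h; simpa using h
    | succ n ih => intro k h; exact hG k (ih _ (by rwa [pow_succ, mul_assoc] at h))
  have descend : ∀ b, G ∣ σ b → F ∣ b := by
    rintro b ⟨a, ha⟩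
    obtain ⟨n, c, hc⟩ := hd a
    obtain ⟨e', he'⟩ := he
    obtain ⟨m, c', hc'⟩ := hd e'
    have h : F ∣ d ^ (m + n + 1) * b := by
      refine ⟨c * c', hσ ?_⟩
      simp only [map_mul, map_pow, ha, hc, hc', hFG]
      rw [pow_succ, pow_add, he']
      ring
    exact (hF.dvd_or_dvd h).resolve_left fun h => hFd (hF.dvd_of_dvd_pow h)
  refine ⟨?_, hG_unit, ?_⟩
  · rintro rfl
    exact hF.ne_zero (hσ (by simpa using hFG))
  · intro f h hfh
    obtain ⟨m, f', hf'⟩ := hd f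
    obtain ⟨n, h', hh'⟩ := hd h
    have hdvd : F ∣ f' * h' := by
      apply descend
      rw [map_mul, hf', hh', mul_mul_mul_comm]
      exact hfh.mul_left _
    refine (hF.dvd_or_dvd hdvd).imp (fun hd' => hGpow m f ?_) (fun hd' => hGpow n h ?_)
    · rw [← hf']; exact ascend _ hd'
    · rw [← hh']; exact ascend _ hd'

/-- A prime that does not divide `G` can be cancelled from a multiple of `G`. -/
theorem dvd_of_dvd_prime_mul {A : Type*} [CommRing A] [IsDomain A] {π G k : A} (hπ : Prime π)
    (h : ¬ π ∣ G) (hk : G ∣ π * k) : G ∣ k := by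
  obtain ⟨m, hm⟩ := hk
  obtain ⟨m', rfl⟩ := (hπ.dvd_or_dvd (Dvd.intro k hm)).resolve_left h
  exact ⟨m', mul_left_cancel₀ hπ.ne_zero (by rw [hm]; ring)⟩

theorem prime_sB : Prime sB := by
  rw [← MulEquiv.prime_iff (finSuccEquiv ℂ 1).toMulEquiv]
  have h : (finSuccEquiv ℂ 1).toMulEquiv sB =
      Polynomial.C (X 0) * Polynomial.X + Polynomial.C 1 := by
    change finSuccEquiv ℂ 1 sB = _
    have h1 : finSuccEquiv ℂ 1 (X 1) = Polynomial.C (X 0) := finSuccEquiv_X_succ (j := 0)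
    simp only [sB, map_add, map_mul, map_one, finSuccEquiv_X_zero, h1]
    ring
  rw [h]
  exact (Polynomial.irreducible_C_mul_X_add_C (X_ne_zero _) isRelPrime_one_right).prime

/-- The ring `ℂ[p][s]`, with `p` the inner variable and `s` the outer one. -/
abbrev PSRing := Polynomial (Polynomial ℂ)

/-- The map `ℂ[p][s] → ℂ[x,y]` sending `p` and `s` to the polynomials of the same name. -/
def substPS : PSRing →+* R2 :=
  Polynomial.eval₂RingHom (Polynomial.eval₂RingHom C pB) sB

@[simp]
theorem substPS_X : substPS Polynomial.X = sB := by simp [substPS]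

@[simp]
theorem substPS_C_X : substPS (Polynomial.C Polynomial.X) = pB := by simp [substPS]

@[simp]
theorem substPS_C_C (c : ℂ) : substPS (Polynomial.C (Polynomial.C c)) = C c := by
  simp [substPS]

theorem substPS_injective : Function.Injective substPS := by
  obtain ⟨K, _, ι, hι⟩ : ∃ (K : Type) (_ : Field K) (ι : PSRing →+* K), Function.Injective ι :=
    ⟨FractionRing PSRing, inferInstance, algebraMap PSRing _, IsFractionRing.injective PSRing _⟩
  have hs : ι Polynomial.X ≠ 0 := (map_ne_zero_iff ι hι).2 Polynomial.X_ne_zero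
  have hp : ι (Polynomial.C Polynomial.X) - 1 ≠ 0 := by
    rw [← map_one ι, ← map_sub, map_ne_zero_iff ι hι, ← Polynomial.C_1, ← Polynomial.C_sub,
      Polynomial.C_ne_zero, ← Polynomial.C_1]
    exact Polynomial.X_sub_C_ne_zero 1
  let θ : R2 →+* K := eval₂Hom (ι.comp (Polynomial.C.comp Polynomial.C))
    ![(ι (Polynomial.C Polynomial.X) - 1) / ι Polynomial.X,
      ι Polynomial.X * (ι Polynomial.X - 1) / (ι (Polynomial.C Polynomial.X) - 1)]
  have hθs : θ sB = ι Polynomial.X := by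
    simp only [θ, sB, map_add, map_mul, map_one, eval₂Hom_X', Matrix.cons_val_zero,
      Matrix.cons_val_one]
    field_simp
    ring
  have hθp : θ pB = ι (Polynomial.C Polynomial.X) := by
    rw [pB, map_add, map_mul, hθs]
    simp only [θ, map_one, eval₂Hom_X', Matrix.cons_val_zero]
    field_simp
    ring
  have hcomp : θ.comp substPS = ι := by
    refine Polynomial.ringHom_ext' (Polynomial.ringHom_ext' ?_ ?_) ?_
    · ext c
      simp [θ]
    · simp [hθp]
    · simp [hθs]
  have : Function.Injective (θ.comp substPS) := hcomp ▸ hι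
  exact Function.Injective.of_comp (f := θ) this

/-- The element `s(p - 1)`, whose inversion identifies `ℂ[p,s]` with `ℂ[x,y]`. -/
def denomPS : PSRing := Polynomial.X * (Polynomial.C Polynomial.X - 1)

theorem substPS_denomPS : substPS denomPS = sB * (X 0 * sB) := by
  simp [denomPS, pB]

theorem exists_substPS_eq (f : R2) :
    ∃ (n : ℕ) (b : PSRing), substPS b = substPS denomPS ^ n * f := by
  induction f using MvPolynomial.induction_on with
  | C c => exact ⟨0, Polynomial.C (Polynomial.C c), by simp⟩
  | add f h hf hh =>
    obtain ⟨m, b, hb⟩ := hf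
    obtain ⟨n, c, hc⟩ := hh
    refine ⟨m + n, denomPS ^ n * b + denomPS ^ m * c, ?_⟩
    simp only [map_add, map_mul, map_pow, hb, hc]
    ring
  | mul_X f i hf =>
    obtain ⟨n, b, hb⟩ := hf
    fin_cases i
    · refine ⟨n + 1, b * (Polynomial.C Polynomial.X - 1) ^ 2, ?_⟩
      simp only [map_mul, map_pow, map_sub, map_one, hb, substPS_C_X, pow_succ _ n,
        substPS_denomPS, pB, Fin.zero_eta]
      ring
    · refine ⟨n + 1, b * (Polynomial.X ^ 2 * (Polynomial.X - 1)), ?_⟩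
      simp only [map_mul, map_pow, map_sub, map_one, hb, substPS_X, pow_succ _ n,
        substPS_denomPS, Fin.mk_one]
      simp only [sB]
      ring

/-- The family `p²u - a ps - b s`. -/
def briancon (a b : ℂ) : R2 := pB ^ 2 * uB - C a * pB * sB - C b * sB

/-- The polynomial `(1 + a)p² + (b - a)p - b`. -/
def linCoeff (a b : ℂ) : Polynomial ℂ :=
  Polynomial.C (1 + a) * Polynomial.X ^ 2 + Polynomial.C (b - a) * Polynomial.X - Polynomial.C b

theorem natDegree_linCoeff_le (a b : ℂ) : (linCoeff a b).natDegree ≤ 2 := by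
  unfold linCoeff
  compute_degree

theorem not_X_dvd_linCoeff {a b : ℂ} (hb : b ≠ 0) : ¬ Polynomial.X ∣ linCoeff a b := by
  rw [Polynomial.X_dvd_iff]
  simpa [linCoeff] using hb

theorem substPS_C_linCoeff (a b : ℂ) : substPS (Polynomial.C (linCoeff a b)) =
    (1 + C a) * pB ^ 2 + (C b - C a) * pB - C b := by
  simp only [linCoeff, map_sub, map_add, map_mul, map_pow, map_one, substPS_C_C, substPS_C_X]

theorem not_isUnit_briancon_sub (a b t : ℂ) : ¬ IsUnit (briancon a b - C t) := by
  intro h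
  obtain ⟨c, -, hc⟩ := isUnit_iff_eq_C_of_isReduced.1 h
  have h0 := congrArg (eval ![0, 0]) hc
  have h1 := congrArg (eval ![0, 1]) hc
  simp [briancon, pB, uB, sB] at h0 h1
  have : (1 : ℂ) = 0 := by linear_combination h1 - h0
  exact one_ne_zero this

theorem not_X_dvd_briancon_sub (a b t : ℂ) : ¬ X 0 ∣ briancon a b - C t := by
  rintro ⟨m, hm⟩
  have h0 := congrArg (eval ![0, 0]) hm
  have h1 := congrArg (eval ![0, 1]) hm
  simp [briancon, pB, uB, sB] at h0 h1
  have : (1 : ℂ) = 0 := by linear_combination h1 - h0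
  exact one_ne_zero this

theorem not_sB_dvd_briancon_sub (a b t : ℂ) : ¬ sB ∣ briancon a b - C t := by
  rintro ⟨m, hm⟩
  have h0 := congrArg (eval ![-1, 1]) hm
  have h1 := congrArg (eval ![1, -1]) hm
  simp [briancon, pB, uB, sB] at h0 h1
  have : (2 : ℂ) = 0 := by linear_combination h0 - h1
  exact two_ne_zero this

theorem dvd_of_dvd_substPS_denomPS_mul (a b t : ℂ) (k : R2)
    (h : briancon a b - C t ∣ substPS denomPS * k) : briancon a b - C t ∣ k := by
  rw [substPS_denomPS, mul_assoc, mul_assoc] at h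
  have hs := not_sB_dvd_briancon_sub a b t
  exact dvd_of_dvd_prime_mul prime_sB hs <|
    dvd_of_dvd_prime_mul X_prime (not_X_dvd_briancon_sub a b t) <|
    dvd_of_dvd_prime_mul prime_sB hs h

/-- The equation `p³s - q` of the zero fiber in the coordinates `p, s`. -/
def zeroFiberPS (a b : ℂ) : PSRing :=
  Polynomial.C (Polynomial.X ^ 3) * Polynomial.X + Polynomial.C (-linCoeff a b)

theorem substPS_zeroFiberPS (a b : ℂ) :
    substPS (zeroFiberPS a b) = X 0 * (briancon a b - C 0) := by
  simp only [zeroFiberPS, map_add, map_mul, map_neg, map_pow, substPS_C_linCoeff, substPS_C_X,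
    substPS_X, briancon, pB, uB, sB, map_zero]
  ring

theorem prime_zeroFiberPS {a b : ℂ} (hb : b ≠ 0) : Prime (zeroFiberPS a b) := by
  refine (Polynomial.irreducible_C_mul_X_add_C (pow_ne_zero _ Polynomial.X_ne_zero) ?_).prime
  refine IsRelPrime.neg_right (IsRelPrime.pow_left ?_)
  exact (Polynomial.irreducible_X.isRelPrime_iff_not_dvd).2 (not_X_dvd_linCoeff hb)

/-- The equation `p³s² - qs - t(p - 1)` of the fiber over `t` in the coordinates `p, s`. -/
def fiberPS (a b t : ℂ) : PSRing :=
  Polynomial.C (Polynomial.X ^ 3) * Polynomial.X ^ 2 +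
    Polynomial.C (-linCoeff a b) * Polynomial.X +
    Polynomial.C (Polynomial.C (-t) * (Polynomial.X - Polynomial.C 1))

theorem substPS_fiberPS (a b t : ℂ) :
    substPS (fiberPS a b t) = X 0 * sB * (briancon a b - C t) := by
  simp only [fiberPS, map_add, map_mul, map_neg, map_pow, map_sub, substPS_C_linCoeff,
    substPS_C_X, substPS_C_C, substPS_X, briancon, pB, uB, sB, map_one]
  ring

theorem false_of_linear_factors {q α β γ δ : Polynomial ℂ} {t : ℂ} (hq : q.natDegree ≤ 2)
    (ht : t ≠ 0) (h2 : α * γ = Polynomial.X ^ 3) (h1 : α * δ + β * γ = -q)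
    (h0 : β * δ = Polynomial.C (-t) * (Polynomial.X - Polynomial.C 1))
    (hα : ¬ Polynomial.X ∣ α) : False := by
  have hγ : Polynomial.X ^ 3 ∣ γ :=
    Polynomial.prime_X.pow_dvd_of_dvd_mul_left 3 hα (Dvd.intro_left 1 (by rw [h2, one_mul]))
  have hX : α * γ ≠ 0 := h2 ▸ pow_ne_zero _ Polynomial.X_ne_zero
  have hne : β * δ ≠ 0 := by
    rw [h0]
    exact mul_ne_zero (by simpa using ht) (Polynomial.X_sub_C_ne_zero 1)
  have hγ3 : 3 ≤ γ.natDegree := by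
    simpa using Polynomial.natDegree_le_of_dvd hγ (right_ne_zero_of_mul hX)
  have hdeg := congrArg Polynomial.natDegree h2
  rw [Polynomial.natDegree_mul (left_ne_zero_of_mul hX) (right_ne_zero_of_mul hX),
    Polynomial.natDegree_X_pow] at hdeg
  have hdeg0 := congrArg Polynomial.natDegree h0
  rw [Polynomial.natDegree_mul (left_ne_zero_of_mul hne) (right_ne_zero_of_mul hne),
    Polynomial.natDegree_C_mul (neg_ne_zero.2 ht), Polynomial.natDegree_X_sub_C] at hdeg0
  have hprod : (β * γ).natDegree ≤ 2 := by
    rw [eq_sub_of_add_eq' h1]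
    refine (Polynomial.natDegree_sub_le _ _).trans (max_le (by simpa using hq) ?_)
    exact Polynomial.natDegree_mul_le.trans (by omega)
  rw [Polynomial.natDegree_mul (left_ne_zero_of_mul hne) (right_ne_zero_of_mul hX)] at hprod
  omega

theorem coeff_quadratic {A : Type*} [CommRing A] {P : Polynomial A} {a b c : A}
    (h : P = Polynomial.C a * Polynomial.X ^ 2 + Polynomial.C b * Polynomial.X + Polynomial.C c) :
    P.coeff 0 = c ∧ P.coeff 1 = b ∧ P.coeff 2 = a := by
  subst h
  refine ⟨?_, ?_, ?_⟩ <;> simp [Polynomial.coeff_X, Polynomial.coeff_C]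

theorem natDegree_fiberPS (a b t : ℂ) : (fiberPS a b t).natDegree = 2 :=
  Polynomial.natDegree_quadratic (pow_ne_zero _ Polynomial.X_ne_zero)

theorem isPrimitive_fiberPS (a b : ℂ) {t : ℂ} (ht : t ≠ 0) : (fiberPS a b t).IsPrimitive := by
  intro r hr
  rw [Polynomial.C_dvd_iff_dvd_coeff] at hr
  obtain ⟨c0, -, c2⟩ := coeff_quadratic (P := fiberPS a b t) rfl
  have h0 := hr 0
  have h2 := hr 2
  rw [c0] at h0
  rw [c2] at h2
  have hcop : IsRelPrime (Polynomial.X ^ 3 : Polynomial ℂ)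
      (Polynomial.C (-t) * (Polynomial.X - Polynomial.C 1)) := by
    refine IsRelPrime.pow_left ((Polynomial.irreducible_X.isRelPrime_iff_not_dvd).2 ?_)
    rw [Polynomial.X_dvd_iff]
    simpa using ht
  exact hcop h2 h0

theorem prime_fiberPS {a b t : ℂ} (hb : b ≠ 0) (ht : t ≠ 0) : Prime (fiberPS a b t) := by
  have hprim := isPrimitive_fiberPS a b ht
  have hdeg := natDegree_fiberPS a b t
  have hunit : ∀ P, P ∣ fiberPS a b t → P.natDegree = 0 → IsUnit P := by
    intro P hP hP0
    rw [Polynomial.eq_C_of_natDegree_eq_zero hP0] at hP ⊢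
    exact (hprim _ hP).map Polynomial.C
  refine Irreducible.prime ⟨fun h => ?_, fun P Q hPQ => ?_⟩
  · simpa [hdeg] using Polynomial.natDegree_eq_zero_of_isUnit h
  have hsum := congrArg Polynomial.natDegree hPQ
  have hne : P * Q ≠ 0 := hPQ ▸ hprim.ne_zero
  rw [hdeg, Polynomial.natDegree_mul (left_ne_zero_of_mul hne) (right_ne_zero_of_mul hne)] at hsum
  by_contra! hcon
  have hP0 : P.natDegree ≠ 0 := fun h => hcon.1 (hunit P (Dvd.intro _ hPQ.symm) h)
  have hQ0 : Q.natDegree ≠ 0 := fun h => hcon.2 (hunit Q (Dvd.intro_left _ hPQ.symm) h)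
  obtain ⟨α, β, rfl⟩ := Polynomial.exists_eq_X_add_C_of_natDegree_le_one (p := P) (by omega)
  obtain ⟨γ, δ, rfl⟩ := Polynomial.exists_eq_X_add_C_of_natDegree_le_one (p := Q) (by omega)
  obtain ⟨c0, c1, c2⟩ := coeff_quadratic (P := fiberPS a b t) rfl
  have hexp : (Polynomial.C α * Polynomial.X + Polynomial.C β) *
      (Polynomial.C γ * Polynomial.X + Polynomial.C δ) =
      Polynomial.C (α * γ) * Polynomial.X ^ 2 + Polynomial.C (α * δ + β * γ) * Polynomial.X +
        Polynomial.C (β * δ) := by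
    simp only [map_add, map_mul]
    ring
  obtain ⟨h0, h1, h2⟩ := coeff_quadratic (hPQ.trans hexp)
  rw [c0] at h0
  rw [c1] at h1
  rw [c2] at h2
  have hq := natDegree_linCoeff_le a b
  by_cases hα : Polynomial.X ∣ α
  · refine false_of_linear_factors (α := γ) (β := δ) (γ := α) (δ := β) hq ht
      (by rw [h2, mul_comm]) (by rw [h1]; ring) (by rw [h0, mul_comm]) fun hγ => ?_
    refine not_X_dvd_linCoeff (a := a) hb ?_
    rw [← dvd_neg, h1]
    exact dvd_add (hα.mul_right _) (hγ.mul_left _)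
  · exact false_of_linear_factors hq ht h2.symm h1.symm h0.symm hα

theorem prime_briancon_sub (a : ℂ) {b : ℂ} (hb : b ≠ 0) (t : ℂ) :
    Prime (briancon a b - C t) := by
  have hcancel := dvd_of_dvd_substPS_denomPS_mul a b t
  have hunit := not_isUnit_briancon_sub a b t
  by_cases ht : t = 0
  · subst ht
    exact prime_of_localization substPS substPS_injective denomPS exists_substPS_eq
      (prime_zeroFiberPS hb) (by rw [substPS_denomPS]; exact ⟨sB ^ 2, by ring⟩)
      (substPS_zeroFiberPS a b) hunit hcancel
  · exact prime_of_localization substPS substPS_injective denomPS exists_substPS_eq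
      (prime_fiberPS hb ht) (by rw [substPS_denomPS]; exact ⟨sB, by ring⟩)
      (substPS_fiberPS a b t) hunit hcancel

/-- All the fibers of the polynomial maps `g, g' : ℂ² → ℂ` are irreducible affine plane
curves: for every `t ∈ ℂ`, the polynomials `g - t` and `g' - t` are irreducible. -/
theorem statement6 :
    ∀ t : ℂ, Irreducible (gB - C t) ∧ Irreducible (gB' - C t) := by
  intro t
  have h := (prime_briancon_sub (5 / 3) (b := 1 / 3) (by norm_num) t).irreducible
  have h' := (prime_briancon_sub (7 / 9) (b := -(1 / 9)) (by norm_num) t).irreducible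
  rw [briancon] at h h'
  rw [C_neg, neg_mul, sub_neg_eq_add] at h'
  exact ⟨h, h'⟩

end
end

section
/- The degree 10 plane curves C₀ : f₀ = 0 and C₁ : f₁ = 0 are minimal plus-one generated (MPOG) curves with exponents (5,5,6) and total Tjurina number τ(C₀) = τ(C₁) = 59, and the curve C_b : f_b = 0 is a free curve with exponents (4,5) and τ(C_b) = 61. -/
open MvPolynomial

noncomputable section

/-- The homogenization `f₀` of the Briançon polynomial `g`. -/
def f0 : S3 :=
  X 0 ^ 6 * X 1 ^ 4 + 4 * X 0 ^ 5 * X 1 ^ 3 * X 2 ^ 2 + 3 * X 0 ^ 4 * X 1 ^ 3 * X 2 ^ 3 +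
    6 * X 0 ^ 4 * X 1 ^ 2 * X 2 ^ 4 + C (19 / 3 : ℂ) * X 0 ^ 3 * X 1 ^ 2 * X 2 ^ 5 +
    4 * X 0 ^ 3 * X 1 * X 2 ^ 6 + 3 * X 0 ^ 2 * X 1 ^ 2 * X 2 ^ 6 +
    C (11 / 3 : ℂ) * X 0 ^ 2 * X 1 * X 2 ^ 7 + X 0 ^ 2 * X 2 ^ 8 + 2 * X 0 * X 1 * X 2 ^ 8 +
    C (1 / 3 : ℂ) * X 0 * X 2 ^ 9 + X 1 * X 2 ^ 9 - X 2 ^ 10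

/-- `f_b = f₀ + (16/9) z¹⁰`. -/
def fb : S3 := f0 + C (16 / 9 : ℂ) * X 2 ^ 10

/-- `f₁ = f₀ - z¹⁰`. -/
def f1 : S3 := f0 - X 2 ^ 10

section CrossProduct

variable {R : Type*} [CommRing R]

/-- Two vectors orthogonal to `g` have a cross product proportional to `g`, provided the first
two entries of `g` have no common factor. -/
theorem exists_cross_eq_smul [IsDomain R] [DecompositionMonoid R] {g u v : Fin 3 → R}
    (hg : IsRelPrime (g 0) (g 1)) (hg0 : g 0 ≠ 0) (hu : u ⬝ᵥ g = 0) (hv : v ⬝ᵥ g = 0) :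
    ∃ k : R, crossProduct u v = k • g := by
  rw [Matrix.vec3_dotProduct] at hu hv
  have h01 : (u 1 * v 2 - u 2 * v 1) * g 1 = (u 2 * v 0 - u 0 * v 2) * g 0 := by
    linear_combination v 2 * hu - u 2 * hv
  have h02 : (u 1 * v 2 - u 2 * v 1) * g 2 = (u 0 * v 1 - u 1 * v 0) * g 0 := by
    linear_combination -v 1 * hu + u 1 * hv
  obtain ⟨k, hk⟩ := hg.dvd_of_dvd_mul_right ⟨_, h01.trans (mul_comm _ _)⟩
  refine ⟨k, ?_⟩
  rw [cross_apply]
  ext i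
  fin_cases i
  · simpa [mul_comm k] using hk
  · refine mul_left_cancel₀ hg0 ?_
    simp only [Fin.mk_one, Matrix.cons_val, Pi.smul_apply, smul_eq_mul]
    linear_combination -h01 + g 1 * hk
  · refine mul_left_cancel₀ hg0 ?_
    simp only [Fin.reduceFinMk, Matrix.cons_val, Pi.smul_apply, smul_eq_mul]
    linear_combination -h02 + g 2 * hk

theorem cross_smul_cyclic_sum (u v w : Fin 3 → R) (i : Fin 3) :
    crossProduct v w i • u + crossProduct w u i • v + crossProduct u v i • w =
      (u ⬝ᵥ crossProduct v w) • Pi.single i 1 := by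
  rw [Matrix.vec3_dotProduct]
  simp only [cross_apply]
  ext j
  fin_cases i <;> fin_cases j <;> simp <;> ring

/-- For vectors orthogonal to `g` whose pairwise cross products are multiples of `g`, these
multiples are the coefficients of a linear relation. -/
theorem cyclic_sum_eq_zero [IsDomain R] {g u v w : Fin 3 → R} {a b c : R} (hg0 : g 0 ≠ 0)
    (hu : u ⬝ᵥ g = 0) (ha : crossProduct v w = a • g) (hb : crossProduct w u = b • g)
    (hc : crossProduct u v = c • g) : a • u + b • v + c • w = 0 := by
  have h := cross_smul_cyclic_sum u v w 0
  rw [ha, hb, hc, dotProduct_smul, hu, smul_zero, zero_smul] at h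
  refine (smul_eq_zero_iff_right hg0).1 (h ▸ ?_)
  ext i
  simp only [Pi.add_apply, Pi.smul_apply, smul_eq_mul]
  ring

/-- Two vectors whose cross product is a unit multiple of `g` span the orthogonal of `g`. -/
theorem mem_span_pair_of_dotProduct_eq_zero [IsDomain R] [DecompositionMonoid R]
    {g u₁ u₂ v : Fin 3 → R} {c : R} (hg : IsRelPrime (g 0) (g 1)) (hg0 : g 0 ≠ 0) (hc : IsUnit c)
    (h₁ : u₁ ⬝ᵥ g = 0) (h₂ : u₂ ⬝ᵥ g = 0) (h₁₂ : crossProduct u₁ u₂ = c • g)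
    (hv : v ⬝ᵥ g = 0) : v ∈ Submodule.span R {u₁, u₂} := by
  obtain ⟨k₁, hk₁⟩ := exists_cross_eq_smul hg hg0 hv h₁
  obtain ⟨k₂, hk₂⟩ := exists_cross_eq_smul hg hg0 h₂ hv
  obtain ⟨e, rfl⟩ := hc
  have h := cyclic_sum_eq_zero hg0 hv h₁₂ hk₂ hk₁
  have he : ((↑e⁻¹ : R) * (e : R)) = 1 := by simp
  refine Submodule.mem_span_pair.2 ⟨-(↑e⁻¹ * k₂), -(↑e⁻¹ * k₁), ?_⟩
  ext i
  have hi := congrFun h i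
  simp only [Pi.add_apply, Pi.smul_apply, smul_eq_mul, Pi.zero_apply] at hi ⊢
  linear_combination (-(↑e⁻¹ : R)) * hi + v i * he

theorem eq_zero_of_smul_add_smul_eq_zero [IsDomain R] {g u₁ u₂ : Fin 3 → R} {c a b : R}
    (hg0 : g 0 ≠ 0) (hc : c ≠ 0) (h₁₂ : crossProduct u₁ u₂ = c • g)
    (h : a • u₁ + b • u₂ = 0) : a = 0 ∧ b = 0 := by
  have ha : crossProduct (a • u₁ + b • u₂) u₂ 0 = a * (c * g 0) := by
    simp [h₁₂]
  have hb : crossProduct u₁ (a • u₁ + b • u₂) 0 = b * (c * g 0) := by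
    simp [h₁₂]
  rw [h] at ha hb
  simp only [map_zero, LinearMap.zero_apply, Pi.zero_apply] at ha hb
  have hcg : c * g 0 ≠ 0 := mul_ne_zero hc hg0
  exact ⟨(mul_eq_zero.1 ha.symm).resolve_right hcg, (mul_eq_zero.1 hb.symm).resolve_right hcg⟩

/-- The syzygies of `h₁, h₂, h₃` are generated by the Koszul ones if `h₁, h₂` have no common
factor and are fixed by a retraction `σ` onto a complement of the ideal `(h₃)`. -/
theorem exists_koszul [IsDomain R] [DecompositionMonoid R] {h₁ h₂ h₃ : R} (σ : R →+* R)
    (hσ₁ : σ h₁ = h₁) (hσ₂ : σ h₂ = h₂) (hσ₃ : σ h₃ = 0) (hσ : ∀ p, h₃ ∣ p - σ p)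
    (hrel : IsRelPrime h₁ h₂) (hne₁ : h₁ ≠ 0) (hne₃ : h₃ ≠ 0) {a₁ a₂ a₃ : R}
    (ha : h₁ * a₁ + h₂ * a₂ + h₃ * a₃ = 0) :
    ∃ b₁ b₂ b₃, a₁ = b₃ * h₂ - b₂ * h₃ ∧ a₂ = b₁ * h₃ - b₃ * h₁ ∧ a₃ = b₂ * h₁ - b₁ * h₂ := by
  have h := congrArg σ ha
  simp only [map_add, map_mul, hσ₁, hσ₂, hσ₃, zero_mul, add_zero, map_zero] at h
  obtain ⟨k, hk⟩ : h₁ ∣ σ a₂ :=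
    hrel.dvd_of_dvd_mul_left ⟨-σ a₁, by linear_combination h⟩
  have hk₁ : σ a₁ = -k * h₂ := mul_left_cancel₀ hne₁ (by linear_combination h - h₂ * hk)
  obtain ⟨m, hm⟩ := hσ a₁
  obtain ⟨n, hn⟩ := hσ a₂
  refine ⟨n, -m, -k, by linear_combination hm + hk₁, by linear_combination hn + hk, ?_⟩
  refine mul_left_cancel₀ hne₃ ?_
  linear_combination ha - h₁ * (hm + hk₁) - h₂ * (hn + hk)

variable {g u₁ u₂ u₃ : Fin 3 → R} {h₁ h₂ h₃ : R}

/-- Three vectors whose pairwise cross products are the multiples `h₁, h₂, h₃` of `g` span the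
orthogonal of `g` when the syzygies of `h₁, h₂, h₃` are generated by the Koszul ones. -/
theorem mem_span_triple_of_dotProduct_eq_zero [IsDomain R] [DecompositionMonoid R]
    (hg : IsRelPrime (g 0) (g 1)) (hg0 : g 0 ≠ 0) (hne₃ : h₃ ≠ 0)
    (ho₁ : u₁ ⬝ᵥ g = 0) (ho₂ : u₂ ⬝ᵥ g = 0) (ho₃ : u₃ ⬝ᵥ g = 0)
    (h₂₃ : crossProduct u₂ u₃ = h₁ • g) (h₃₁ : crossProduct u₃ u₁ = h₂ • g)
    (h₁₂ : crossProduct u₁ u₂ = h₃ • g)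
    (hK : ∀ a₁ a₂ a₃, h₁ * a₁ + h₂ * a₂ + h₃ * a₃ = 0 → ∃ b₁ b₂ b₃,
      a₁ = b₃ * h₂ - b₂ * h₃ ∧ a₂ = b₁ * h₃ - b₃ * h₁ ∧ a₃ = b₂ * h₁ - b₁ * h₂)
    {v : Fin 3 → R} (hv : v ⬝ᵥ g = 0) : v ∈ Submodule.span R {u₁, u₂, u₃} := by
  obtain ⟨k₁, hk₁⟩ := exists_cross_eq_smul hg hg0 hv ho₁
  obtain ⟨k₂, hk₂⟩ := exists_cross_eq_smul hg hg0 hv ho₂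
  obtain ⟨k₃, hk₃⟩ := exists_cross_eq_smul hg hg0 hv ho₃
  have hrel : h₁ * k₁ + h₂ * k₂ + h₃ * k₃ = 0 := by
    have h := congrArg (fun w ↦ crossProduct v w 0) (cyclic_sum_eq_zero hg0 ho₁ h₂₃ h₃₁ h₁₂)
    simp only [map_add, map_smul, hk₁, hk₂, hk₃, map_zero, Pi.add_apply, Pi.smul_apply,
      Pi.zero_apply, smul_eq_mul] at h
    refine mul_right_cancel₀ hg0 ?_
    linear_combination h
  obtain ⟨b₁, b₂, b₃, e₁, e₂, -⟩ := hK _ _ _ hrel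
  refine Submodule.mem_span_triple.2 ⟨b₁, b₂, b₃, (sub_eq_zero.1 ?_).symm⟩
  set w := v - (b₁ • u₁ + b₂ • u₂ + b₃ • u₃) with hw
  have hwg : w ⬝ᵥ g = 0 := by
    simp [hw, sub_dotProduct, add_dotProduct, smul_dotProduct, hv, ho₁, ho₂, ho₃]
  have hw₁ : crossProduct w u₁ = (0 : R) • g := by
    rw [hw, map_sub, map_add, map_add, map_smul, map_smul, map_smul]
    simp only [LinearMap.sub_apply, LinearMap.add_apply, LinearMap.smul_apply, cross_self, hk₁,
      h₃₁, ← cross_anticomm u₁ u₂, h₁₂, e₁]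
    module
  have hw₂ : crossProduct u₂ w = (0 : R) • g := by
    rw [← cross_anticomm, hw, map_sub, map_add, map_add, map_smul, map_smul, map_smul]
    simp only [LinearMap.sub_apply, LinearMap.add_apply, LinearMap.smul_apply, cross_self, hk₂,
      h₁₂, ← cross_anticomm u₂ u₃, h₂₃, e₂]
    module
  have h := cyclic_sum_eq_zero hg0 hwg h₁₂ hw₂ hw₁
  rw [zero_smul, zero_smul, add_zero, add_zero] at h
  exact (smul_eq_zero_iff_right hne₃).1 h

/-- The linear relations between three vectors whose pairwise cross products are the multiples
`h₁, h₂, h₃` of `g` are the multiples of `(h₁, h₂, h₃)`. -/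
theorem exists_eq_mul_of_smul_sum_eq_zero [IsDomain R] [DecompositionMonoid R]
    (hg0 : g 0 ≠ 0) (hrel : IsRelPrime h₁ h₂) (hne₁ : h₁ ≠ 0)
    (h₂₃ : crossProduct u₂ u₃ = h₁ • g) (h₃₁ : crossProduct u₃ u₁ = h₂ • g)
    (h₁₂ : crossProduct u₁ u₂ = h₃ • g) {b₁ b₂ b₃ : R}
    (hb : b₁ • u₁ + b₂ • u₂ + b₃ • u₃ = 0) :
    ∃ q, b₁ = q * h₁ ∧ b₂ = q * h₂ ∧ b₃ = q * h₃ := by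
  have e₂ : b₁ * h₃ = b₃ * h₁ := by
    have h := congrArg (fun w ↦ crossProduct w u₂ 0) hb
    simp only [map_add, map_smul, LinearMap.add_apply, LinearMap.smul_apply, cross_self,
      ← cross_anticomm u₂ u₃, h₂₃, h₁₂, map_zero, Pi.add_apply, Pi.smul_apply, Pi.neg_apply,
      Pi.zero_apply, smul_eq_mul, LinearMap.zero_apply] at h
    refine mul_right_cancel₀ hg0 ?_
    linear_combination h
  have e₃ : b₂ * h₁ = b₁ * h₂ := by
    have h := congrArg (fun w ↦ crossProduct w u₃ 0) hb
    simp only [map_add, map_smul, LinearMap.add_apply, LinearMap.smul_apply, cross_self,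
      ← cross_anticomm u₃ u₁, h₂₃, h₃₁, map_zero, Pi.add_apply, Pi.smul_apply, Pi.neg_apply,
      Pi.zero_apply, smul_eq_mul, LinearMap.zero_apply] at h
    refine mul_right_cancel₀ hg0 ?_
    linear_combination h
  obtain ⟨q, rfl⟩ := hrel.dvd_of_dvd_mul_right ⟨b₂, e₃.symm.trans (mul_comm _ _)⟩
  refine ⟨q, mul_comm _ _, mul_left_cancel₀ hne₁ ?_, mul_left_cancel₀ hne₁ ?_⟩
  · linear_combination e₃
  · linear_combination -e₂

end CrossProduct

section Graded

/-- Rank-nullity on a graded piece: `P` and `Q` are pieces of the source and of the target of `F`,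
cut out by projections which `F` intertwines. -/
theorem finrank_ker_inf_add_finrank_range_inf {K V W : Type*} [Field K] [AddCommGroup V]
    [Module K V] [AddCommGroup W] [Module K W] (F : V →ₗ[K] W) (P : Submodule K V)
    (Q : Submodule K W) [FiniteDimensional K P] (πV : V → V) (πW : W → W) (hV : ∀ v, πV v ∈ P)
    (hW : ∀ w ∈ Q, πW w = w) (hPQ : ∀ v ∈ P, F v ∈ Q) (hF : ∀ v, F (πV v) = πW (F v)) :
    Module.finrank K ↥(LinearMap.ker F ⊓ P) + Module.finrank K ↥(LinearMap.range F ⊓ Q) =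
      Module.finrank K P := by
  have hmap : P.map F = LinearMap.range F ⊓ Q := by
    ext w
    constructor
    · rintro ⟨v, hv, rfl⟩
      exact ⟨⟨v, rfl⟩, hPQ v hv⟩
    · rintro ⟨⟨v, rfl⟩, hQ⟩
      exact ⟨πV v, hV v, by rw [hF, hW _ hQ]⟩
  have hker : (LinearMap.ker (F.domRestrict P)).map P.subtype = LinearMap.ker F ⊓ P := by
    rw [LinearMap.ker_domRestrict, Submodule.map_comap_subtype, inf_comm]
  rw [← hker, ← hmap, LinearEquiv.finrank_eq
    (Submodule.equivMapOfInjective P.subtype P.injective_subtype _).symm,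
    ← LinearMap.range_domRestrict, add_comm, LinearMap.finrank_range_add_finrank_ker]

theorem finite_setOf_degree_eq (n : ℕ) : {d : Fin 3 →₀ ℕ | d.degree = n}.Finite := by
  refine (Finset.finite_toSet (Finset.finsuppAntidiag Finset.univ n)).subset fun d hd ↦ ?_
  simpa [Finset.mem_finsuppAntidiag, Finsupp.degree_eq_sum] using hd

instance finiteDimensional_homogeneousSubmodule (n : ℕ) :
    FiniteDimensional ℂ (homogeneousSubmodule (Fin 3) ℂ n) := by
  have := (finite_setOf_degree_eq n).to_subtype
  rw [homogeneousSubmodule_eq_finsupp_supported]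
  exact Module.Finite.equiv (AddMonoidAlgebra.supportedEquivFinsupp _).symm

theorem finrank_homogeneousSubmodule (n : ℕ) :
    Module.finrank ℂ (homogeneousSubmodule (Fin 3) ℂ n) = (n + 2).choose 2 := by
  have hfin := finite_setOf_degree_eq n
  have := hfin.fintype
  rw [homogeneousSubmodule_eq_finsupp_supported,
    LinearEquiv.finrank_eq (AddMonoidAlgebra.supportedEquivFinsupp _), Module.finrank_finsupp_self,
    ← Set.toFinset_card]
  have : {d : Fin 3 →₀ ℕ | d.degree = n}.toFinset = Finset.finsuppAntidiag Finset.univ n := by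
    ext d
    simp [Finset.mem_finsuppAntidiag, Finsupp.degree_eq_sum]
  rw [this, Finset.card_finsuppAntidiag_nat_eq_choose]
  simp only [Finset.card_univ, Fintype.card_fin]
  rw [show 3 + n - 1 = n + 2 by omega, Nat.choose_symm_add]

attribute [local instance] MvPolynomial.gradedAlgebra in
theorem homogeneousComponent_mul_of_isHomogeneous {p q : S3} {m n : ℕ} (hq : q.IsHomogeneous n) :
    homogeneousComponent (m + n) (p * q) = homogeneousComponent m p * q := by
  simpa [← decomposition.decompose'_apply] using
    DirectSum.coe_decompose_mul_add_of_right_mem (homogeneousSubmodule (Fin 3) ℂ) (i := m)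
      (a := p) ((mem_homogeneousSubmodule n q).2 hq)

variable {ι : Type*}

/-- Vectors of polynomials, the entry `i` being homogeneous of degree `d i`. -/
def homogeneousVectors (d : ι → ℕ) : Submodule ℂ (ι → S3) :=
  Submodule.pi Set.univ fun i ↦ homogeneousSubmodule (Fin 3) ℂ (d i)

theorem mem_homogeneousVectors {d : ι → ℕ} {v : ι → S3} :
    v ∈ homogeneousVectors d ↔ ∀ i, (v i).IsHomogeneous (d i) := by
  simp [homogeneousVectors, Submodule.mem_pi]

/-- The space of vectors of homogeneous polynomials is a product of spaces of polynomials. -/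
def homogeneousVectorsEquiv (d : ι → ℕ) :
    homogeneousVectors d ≃ₗ[ℂ] ∀ i, homogeneousSubmodule (Fin 3) ℂ (d i) where
  toFun v i := ⟨v.1 i, v.2 i trivial⟩
  invFun v := ⟨fun i ↦ v i, fun i _ ↦ (v i).2⟩
  map_add' _ _ := rfl
  map_smul' _ _ := rfl
  left_inv _ := rfl
  right_inv _ := rfl

variable [Fintype ι]

instance finiteDimensional_homogeneousVectors (d : ι → ℕ) :
    FiniteDimensional ℂ (homogeneousVectors d) :=
  Module.Finite.equiv (homogeneousVectorsEquiv d).symm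

theorem finrank_homogeneousVectors (d : ι → ℕ) :
    Module.finrank ℂ (homogeneousVectors d) = ∑ i, (d i + 2).choose 2 := by
  rw [LinearEquiv.finrank_eq (homogeneousVectorsEquiv d), Module.finrank_pi_fintype]
  simp [finrank_homogeneousSubmodule]

/-- The degree `n` part of the relations between homogeneous vectors `v j` of degrees `d j`. -/
def relationPiece {m : ℕ} (v : Fin m → Fin 3 → S3) (d : Fin m → ℕ) (n : ℕ) :
    Submodule ℂ (Fin m → S3) :=
  LinearMap.ker ((Fintype.linearCombination S3 v).restrictScalars ℂ) ⊓
    homogeneousVectors fun j ↦ n - d j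

theorem range_linearCombination_pderiv (f : S3) :
    LinearMap.range (Fintype.linearCombination S3 fun i ↦ pderiv i f) = jacobianIdeal f := by
  rw [Fintype.range_linearCombination, jacobianIdeal, Ideal.span]
  congr 1
  ext p
  simp [Fin.exists_fin_succ, eq_comm]

theorem ker_linearCombination_pderiv (f : S3) :
    LinearMap.ker (Fintype.linearCombination S3 fun i ↦ pderiv i f) = jacSyz f := by
  ext v
  rw [LinearMap.mem_ker, Fintype.linearCombination_apply, Fin.sum_univ_three]
  rfl

theorem milnorDim_add_finrank (f : S3) (k : ℕ) :
    milnorDim f k + Module.finrank ℂ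
      ↥((jacobianIdeal f).restrictScalars ℂ ⊓ homogeneousSubmodule (Fin 3) ℂ k) =
      (k + 2).choose 2 := by
  rw [milnorDim, ← finrank_homogeneousSubmodule, inf_comm, ← Submodule.map_comap_subtype,
    LinearEquiv.finrank_eq (Submodule.equivMapOfInjective _ (Submodule.injective_subtype _) _).symm,
    Submodule.finrank_quotient_add_finrank]

/-- The Hilbert function of the Milnor algebra in terms of generators of `jacSyz f` and of their
relations. -/
theorem milnorDim_add_eq {f : S3} {e m : ℕ} (hf : ∀ i, (pderiv i f).IsHomogeneous e)
    {v : Fin m → Fin 3 → S3} {d : Fin m → ℕ} (hv : ∀ j i, (v j i).IsHomogeneous (d j))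
    (hspan : Submodule.span S3 (Set.range v) = jacSyz f) {n : ℕ} (hn : ∀ j, d j ≤ n) :
    milnorDim f (n + e) + 3 * (n + 2).choose 2 + Module.finrank ℂ (relationPiece v d n) =
      (n + e + 2).choose 2 + ∑ j, (n - d j + 2).choose 2 := by
  have hJ := finrank_ker_inf_add_finrank_range_inf
    ((Fintype.linearCombination S3 fun i ↦ pderiv i f).restrictScalars ℂ)
    (homogeneousVectors fun _ : Fin 3 ↦ n) (homogeneousSubmodule (Fin 3) ℂ (n + e))
    (fun v i ↦ homogeneousComponent n (v i)) (homogeneousComponent (n + e))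
    (fun v ↦ mem_homogeneousVectors.2 fun i ↦ homogeneousComponent_isHomogeneous _ _)
    (fun w hw ↦ homogeneousComponent_eq_self hw)
    (fun v hv ↦ by
      simp only [LinearMap.coe_restrictScalars, Fintype.linearCombination_apply, smul_eq_mul]
      exact Submodule.sum_mem _ fun i _ ↦ (mem_homogeneousVectors.1 hv i).mul (hf i))
    (fun v ↦ by
      simp only [LinearMap.coe_restrictScalars, Fintype.linearCombination_apply, smul_eq_mul,
        map_sum, homogeneousComponent_mul_of_isHomogeneous (hf _)])
  have hS := finrank_ker_inf_add_finrank_range_inf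
    ((Fintype.linearCombination S3 v).restrictScalars ℂ)
    (homogeneousVectors fun j ↦ n - d j) (homogeneousVectors fun _ : Fin 3 ↦ n)
    (fun w j ↦ homogeneousComponent (n - d j) (w j)) (fun w i ↦ homogeneousComponent n (w i))
    (fun w ↦ mem_homogeneousVectors.2 fun j ↦ homogeneousComponent_isHomogeneous _ _)
    (fun w hw ↦ funext fun i ↦ homogeneousComponent_eq_self (mem_homogeneousVectors.1 hw i))
    (fun w hw ↦ mem_homogeneousVectors.2 fun i ↦ by
      simp only [LinearMap.coe_restrictScalars, Fintype.linearCombination_apply, smul_eq_mul,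
        Finset.sum_apply, Pi.smul_apply]
      refine Submodule.sum_mem (homogeneousSubmodule (Fin 3) ℂ n) fun j _ ↦ ?_
      have h := (mem_homogeneousVectors.1 hw j).mul (hv j i)
      rwa [Nat.sub_add_cancel (hn j)] at h)
    (fun w ↦ by
      ext1 i
      simp only [LinearMap.coe_restrictScalars, Fintype.linearCombination_apply, smul_eq_mul,
        Finset.sum_apply, Pi.smul_apply, map_sum]
      refine Finset.sum_congr rfl fun j _ ↦ ?_
      rw [← homogeneousComponent_mul_of_isHomogeneous (hv j i), Nat.sub_add_cancel (hn j)])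
  have hker := congrArg (Submodule.restrictScalars ℂ) (ker_linearCombination_pderiv f)
  have hrange := congrArg (Submodule.restrictScalars ℂ) (range_linearCombination_pderiv f)
  have hrange' := congrArg (Submodule.restrictScalars ℂ)
    ((Fintype.range_linearCombination S3 v).trans hspan)
  rw [LinearMap.ker_restrictScalars, LinearMap.range_restrictScalars, hker, hrange,
    finrank_homogeneousVectors] at hJ
  rw [LinearMap.range_restrictScalars, hrange', finrank_homogeneousVectors] at hS
  have hM := milnorDim_add_finrank f (n + e)
  simp only [Finset.sum_const, Finset.card_univ, Fintype.card_fin, smul_eq_mul] at hJ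
  rw [relationPiece]
  have hJM : Module.finrank ℂ ↥((jacSyz f).restrictScalars ℂ ⊓ homogeneousVectors fun _ ↦ n) +
      Module.finrank ℂ ↥((jacobianIdeal f).restrictScalars ℂ ⊓
        homogeneousSubmodule (Fin 3) ℂ (n + e)) = 3 * (n + 2).choose 2 := hJ
  omega

/-- If the relations between the `v j` are the multiples of a homogeneous relation `h`, then its
degree determines the dimensions of the graded pieces. -/
theorem finrank_relationPiece {m : ℕ} {v : Fin m → Fin 3 → S3} {d : Fin m → ℕ} {h : Fin m → S3}
    {e n : ℕ} (hde : ∀ j, d j ≤ e) (hen : e ≤ n) (hh : ∀ j, (h j).IsHomogeneous (e - d j))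
    (hne : h ≠ 0) (hrel : ∀ b : Fin m → S3, ∑ j, b j • v j = 0 ↔ ∃ q : S3, b = q • h) :
    Module.finrank ℂ (relationPiece v d n) = (n - e + 2).choose 2 := by
  have hdeg (j : Fin m) : n - e + (e - d j) = n - d j := by have := hde j; omega
  have hH := finrank_ker_inf_add_finrank_range_inf
    ((LinearMap.toSpanSingleton S3 (Fin m → S3) h).restrictScalars ℂ)
    (homogeneousSubmodule (Fin 3) ℂ (n - e)) (homogeneousVectors fun j ↦ n - d j)
    (homogeneousComponent (n - e)) (fun w j ↦ homogeneousComponent (n - d j) (w j))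
    (fun v ↦ homogeneousComponent_mem _ _)
    (fun w hw ↦ funext fun i ↦ homogeneousComponent_eq_self (mem_homogeneousVectors.1 hw i))
    (fun q hq ↦ mem_homogeneousVectors.2 fun j ↦ by
      simpa [hdeg] using IsHomogeneous.mul hq (hh j))
    (fun q ↦ by
      ext1 j
      simp [← homogeneousComponent_mul_of_isHomogeneous (hh j), hdeg])
  have hker : LinearMap.ker ((LinearMap.toSpanSingleton S3 (Fin m → S3) h).restrictScalars ℂ) =
      ⊥ := by
    rw [LinearMap.ker_eq_bot']
    intro q hq
    simpa [hne] using hq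
  have hrange :
      LinearMap.range ((LinearMap.toSpanSingleton S3 (Fin m → S3) h).restrictScalars ℂ) =
      LinearMap.ker ((Fintype.linearCombination S3 v).restrictScalars ℂ) := by
    ext b
    simp only [LinearMap.mem_range, LinearMap.coe_restrictScalars,
      LinearMap.toSpanSingleton_apply, LinearMap.mem_ker, Fintype.linearCombination_apply, hrel b,
      eq_comm]
  rw [hker, bot_inf_eq, finrank_bot, zero_add, hrange, finrank_homogeneousSubmodule] at hH
  exact hH

theorem relationPiece_eq_bot {m : ℕ} {v : Fin m → Fin 3 → S3} {d : Fin m → ℕ} {n : ℕ}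
    (hrel : ∀ b : Fin m → S3, ∑ j, b j • v j = 0 → b = 0) : relationPiece v d n = ⊥ := by
  rw [eq_bot_iff]
  rintro b ⟨hb, -⟩
  exact hrel b hb

/-- Homogeneous generators of `jacSyz f` are minimal if no relation between them has a
coefficient with a nonzero constant term. -/
theorem isMinGenSyz_of_constantCoeff {f : S3} {m : ℕ} {d : Fin m → ℕ} {v : Fin m → Fin 3 → S3}
    (hv : ∀ j i, (v j i).IsHomogeneous (d j))
    (hspan : Submodule.span S3 (Set.range v) = jacSyz f) (hd : Monotone d)
    (hrel : ∀ b : Fin m → S3, ∑ j, b j • v j = 0 → ∀ j, constantCoeff (b j) = 0) :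
    IsMinGenSyz f m d v := by
  have hmin (j : Fin m) : v j ∉ Submodule.span S3 (v '' {j' | j' ≠ j}) := by
    rw [Finsupp.mem_span_image_iff_linearCombination]
    rintro ⟨l, hl, hlj⟩
    have hlj0 : l j = 0 := by
      by_contra hne
      exact hl (Finsupp.mem_support_iff.2 hne) rfl
    have h := hrel (fun i ↦ l i - Pi.single (M := fun _ ↦ S3) j 1 i) (by
      rw [Finsupp.linearCombination_apply, Finsupp.sum_fintype _ _ (by simp)] at hlj
      simp [sub_smul, Finset.sum_sub_distrib, hlj, Pi.single_apply]) j
    simp [hlj0] at h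
  refine ⟨fun j ↦ hspan ▸ Submodule.subset_span ⟨j, rfl⟩, hv, fun j h0 ↦ hmin j ?_, hspan, hmin,
    hd⟩
  rw [h0]
  exact Submodule.zero_mem _

end Graded

section Curves

theorem isRelPrime_of_dvd_pow {R : Type*} [CommRing R] [IsDomain R] {p q π : R} (hπ : Prime π)
    {n : ℕ} (h : ∀ r, r ∣ p → r ∣ q → r ∣ π ^ n) (hp : ¬ π ∣ p) : IsRelPrime p q := by
  intro r hrp hrq
  obtain ⟨i, -, hi⟩ := (dvd_prime_pow hπ n).1 (h r hrp hrq)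
  rcases i with - | i
  · exact (pow_zero π ▸ hi).isUnit_iff.2 isUnit_one
  · exact absurd (((dvd_pow_self π i.succ_ne_zero).trans hi.symm.dvd).trans hrp) hp

theorem not_X_dvd_of_eval_ne_zero {p : S3} {i : Fin 3} {w : Fin 3 → ℂ} (hw : w i = 0)
    (hp : eval w p ≠ 0) : ¬ (X i : S3) ∣ p := by
  rintro ⟨q, rfl⟩
  simp [hw] at hp

theorem isRelPrime_quadrics {a b c d : ℂ} (ha : a ≠ 0) (hres : b * c ^ 2 + a * d ^ 2 ≠ 0) :
    IsRelPrime (C a * X 0 ^ 2 + C b * X 2 ^ 2 : S3) (C c * X 0 * X 2 - C d * X 2 ^ 2) := by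
  refine isRelPrime_of_dvd_pow (n := 3) (X_prime (i := 2)) (fun r h₁ h₂ ↦ ?_)
    (not_X_dvd_of_eval_ne_zero (w := ![1, 0, 0]) (by simp) (by simpa using ha))
  refine (IsUnit.dvd_mul_left ((isUnit_iff_ne_zero.2 hres).map (C (σ := Fin 3)))).1 ?_
  obtain ⟨s, hs⟩ := h₁
  obtain ⟨t, ht⟩ := h₂
  refine ⟨C c ^ 2 * X 2 * s - C a * (C c * X 0 + C d * X 2) * t, ?_⟩
  simp only [map_add, map_mul, map_pow]
  linear_combination C c ^ 2 * X 2 * hs - C a * (C c * X 0 + C d * X 2) * ht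

/-- Elimination of the variable `X 1` by means of the linear equation
`α * X 0 + β * X 1 - γ * X 2 = 0`. -/
def eliminate (α β γ : ℂ) : S3 →ₐ[ℂ] S3 :=
  aeval ![X 0, C β⁻¹ * (C γ * X 2 - C α * X 0), X 2]

theorem dvd_sub_eliminate {α β γ : ℂ} (hβ : β ≠ 0) (p : S3) :
    C α * X 0 + C β * X 1 - C γ * X 2 ∣ p - eliminate α β γ p := by
  have hC : (C β⁻¹ * C β : S3) = 1 := by rw [← C_mul, inv_mul_cancel₀ hβ, C_1]
  rw [← Ideal.mem_span_singleton, ← Ideal.Quotient.mk_eq_mk_iff_sub_mem]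
  refine DFunLike.congr_fun (F := S3 →ₐ[ℂ] _) (f := Ideal.Quotient.mkₐ ℂ _)
    (g := (Ideal.Quotient.mkₐ ℂ _).comp (eliminate α β γ)) (algHom_ext fun i ↦ ?_) p
  refine Ideal.Quotient.eq.2 (Ideal.mem_span_singleton.2 ?_)
  fin_cases i
  · simp [eliminate]
  · refine ⟨C β⁻¹, ?_⟩
    simp only [eliminate, Fin.mk_one, RingHom.coe_coe, aeval_X, Matrix.cons_val_one,
      Matrix.cons_val_zero]
    linear_combination -X 1 * hC
  · simp [eliminate]

theorem two_mul_choose_two (n : ℕ) : 2 * (n + 1).choose 2 = n * n + n := by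
  have h := Nat.add_one_mul_choose_eq n 1
  rw [Nat.choose_one_right] at h
  linarith

variable {f : S3} {g : Fin 3 → S3}

theorem mem_jacSyz_iff (hf : ∀ i, pderiv i f = C 9⁻¹ * g i) {v : Fin 3 → S3} :
    v ∈ jacSyz f ↔ v ⬝ᵥ g = 0 := by
  have h9 : (C 9⁻¹ : S3) ≠ 0 := by simp
  rw [Matrix.vec3_dotProduct]
  change v 0 * pderiv 0 f + v 1 * pderiv 1 f + v 2 * pderiv 2 f = 0 ↔ _
  rw [hf, hf, hf, show v 0 * (C 9⁻¹ * g 0) + v 1 * (C 9⁻¹ * g 1) + v 2 * (C 9⁻¹ * g 2) =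
    C 9⁻¹ * (v 0 * g 0 + v 1 * g 1 + v 2 * g 2) by ring, mul_eq_zero_iff_left h9]

/-- A pair of syzygies whose cross product is a constant multiple of the gradient. -/
theorem isFreeWith_and_isTjurina (hhom : f.IsHomogeneous 10)
    (hf : ∀ i, pderiv i f = C 9⁻¹ * g i) (hg : IsRelPrime (g 0) (g 1)) (hg0 : g 0 ≠ 0)
    {u₁ u₂ : Fin 3 → S3} (hu₁ : ∀ i, (u₁ i).IsHomogeneous 4) (hu₂ : ∀ i, (u₂ i).IsHomogeneous 5)
    (ho₁ : u₁ ⬝ᵥ g = 0) (ho₂ : u₂ ⬝ᵥ g = 0) {c : ℂ} (hc : c ≠ 0)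
    (h₁₂ : crossProduct u₁ u₂ = (C c : S3) • g) : IsFreeWith f 4 5 ∧ IsTjurina f 61 := by
  have hv : ∀ j i, ((![u₁, u₂] : Fin 2 → Fin 3 → S3) j i).IsHomogeneous (![4, 5] j) := by
    simp [Fin.forall_fin_two, hu₁, hu₂]
  have hspan : Submodule.span S3 (Set.range ![u₁, u₂]) = jacSyz f := by
    rw [Matrix.range_cons, Matrix.range_cons, Matrix.range_empty, Set.union_empty,
      Set.singleton_union]
    refine le_antisymm (Submodule.span_le.2 ?_) fun v hv ↦
      mem_span_pair_of_dotProduct_eq_zero hg hg0 ((isUnit_iff_ne_zero.2 hc).map C) ho₁ ho₂ h₁₂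
        ((mem_jacSyz_iff hf).1 hv)
    rintro v (rfl | rfl)
    exacts [(mem_jacSyz_iff hf).2 ho₁, (mem_jacSyz_iff hf).2 ho₂]
  have hrel (b : Fin 2 → S3) (hb : ∑ j, b j • (![u₁, u₂] : Fin 2 → Fin 3 → S3) j = 0) :
      b = 0 := by
    rw [Fin.sum_univ_two] at hb
    obtain ⟨h0, h1⟩ := eq_zero_of_smul_add_smul_eq_zero hg0 (by simpa using hc) h₁₂ hb
    ext1 j
    fin_cases j
    exacts [h0, h1]
  refine ⟨⟨_, isMinGenSyz_of_constantCoeff hv hspan ?_ fun b hb j ↦ by simp [hrel b hb]⟩, ?_⟩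
  · simp [Fin.monotone_iff_le_succ]
  · filter_upwards [Filter.eventually_ge_atTop 20] with k hk
    obtain ⟨n, rfl⟩ := Nat.exists_eq_add_of_le hk
    have h := milnorDim_add_eq (n := n + 11) (fun i ↦ hhom.pderiv (i := i)) hv hspan (by
      simp [Fin.forall_fin_two])
    rw [relationPiece_eq_bot hrel, finrank_bot, Fin.sum_univ_two] at h
    simp only [Matrix.cons_val_zero, Matrix.cons_val_one] at h
    rw [show n + 11 - 4 = n + 7 by omega, show n + 11 - 5 = n + 6 by omega,
      show n + 11 + (10 - 1) = 20 + n by omega] at h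
    have h₀ := two_mul_choose_two (n + 12)
    have h₁ := two_mul_choose_two (n + 8)
    have h₂ := two_mul_choose_two (n + 7)
    have h₃ := two_mul_choose_two (20 + n + 1)
    linarith

/-- Three syzygies whose pairwise cross products are multiples of the gradient, by forms
`h₁, h₂, h₃` without common zeros of degrees `2, 2, 1`. -/
theorem isMPOGWith_and_isTjurina (hhom : f.IsHomogeneous 10)
    (hf : ∀ i, pderiv i f = C 9⁻¹ * g i) (hg : IsRelPrime (g 0) (g 1)) (hg0 : g 0 ≠ 0)
    {u₁ u₂ u₃ : Fin 3 → S3} (hu₁ : ∀ i, (u₁ i).IsHomogeneous 5)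
    (hu₂ : ∀ i, (u₂ i).IsHomogeneous 5) (hu₃ : ∀ i, (u₃ i).IsHomogeneous 6)
    (ho₁ : u₁ ⬝ᵥ g = 0) (ho₂ : u₂ ⬝ᵥ g = 0) (ho₃ : u₃ ⬝ᵥ g = 0)
    {a b c d α β γ : ℂ} (ha : a ≠ 0) (hres : b * c ^ 2 + a * d ^ 2 ≠ 0) (hβ : β ≠ 0)
    (h₂₃ : crossProduct u₂ u₃ = (C a * X 0 ^ 2 + C b * X 2 ^ 2 : S3) • g)
    (h₃₁ : crossProduct u₃ u₁ = (C c * X 0 * X 2 - C d * X 2 ^ 2 : S3) • g)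
    (h₁₂ : crossProduct u₁ u₂ = (C α * X 0 + C β * X 1 - C γ * X 2 : S3) • g) :
    IsMPOGWith f 10 5 5 ∧ IsTjurina f 59 := by
  have hrelPrime := isRelPrime_quadrics ha hres
  have hne₁ : (C a * X 0 ^ 2 + C b * X 2 ^ 2 : S3) ≠ 0 := fun h ↦ ha (by
    simpa using congrArg (eval ![1, 0, 0]) h)
  have hne₃ : (C α * X 0 + C β * X 1 - C γ * X 2 : S3) ≠ 0 := fun h ↦ hβ (by
    simpa using congrArg (eval ![0, 1, 0]) h)
  have hC : (C β⁻¹ * C β : S3) = 1 := by rw [← C_mul, inv_mul_cancel₀ hβ, C_1]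
  have hv : ∀ j i, ((![u₁, u₂, u₃] : Fin 3 → Fin 3 → S3) j i).IsHomogeneous (![5, 5, 6] j) := by
    intro j
    fin_cases j
    exacts [hu₁, hu₂, hu₃]
  have hspan : Submodule.span S3 (Set.range ![u₁, u₂, u₃]) = jacSyz f := by
    rw [Matrix.range_cons, Matrix.range_cons, Matrix.range_cons, Matrix.range_empty,
      Set.union_empty, Set.singleton_union, Set.singleton_union]
    refine le_antisymm (Submodule.span_le.2 ?_) fun v hv ↦
      mem_span_triple_of_dotProduct_eq_zero hg hg0 hne₃ ho₁ ho₂ ho₃ h₂₃ h₃₁ h₁₂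
        (fun a₁ a₂ a₃ ↦ exists_koszul (eliminate α β γ : S3 →+* S3) ?_ ?_ ?_
          (dvd_sub_eliminate hβ) hrelPrime hne₁ hne₃) ((mem_jacSyz_iff hf).1 hv)
    · rintro v (rfl | rfl | rfl)
      exacts [(mem_jacSyz_iff hf).2 ho₁, (mem_jacSyz_iff hf).2 ho₂, (mem_jacSyz_iff hf).2 ho₃]
    · simp [eliminate, ← algebraMap_eq]
    · simp [eliminate, ← algebraMap_eq]
    · simp only [eliminate, RingHom.coe_coe, map_add, map_sub, map_mul, aeval_X, aeval_C,
        algebraMap_eq, Matrix.cons_val]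
      linear_combination (C γ * X 2 - C α * X 0) * hC
  have hrel (r : Fin 3 → S3) : ∑ j, r j • (![u₁, u₂, u₃] : Fin 3 → Fin 3 → S3) j = 0 ↔
      ∃ q : S3, r = q • ![C a * X 0 ^ 2 + C b * X 2 ^ 2, C c * X 0 * X 2 - C d * X 2 ^ 2,
        C α * X 0 + C β * X 1 - C γ * X 2] := by
    rw [Fin.sum_univ_three]
    constructor
    · intro h
      obtain ⟨q, h0, h1, h2⟩ :=
        exists_eq_mul_of_smul_sum_eq_zero hg0 hrelPrime hne₁ h₂₃ h₃₁ h₁₂ h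
      refine ⟨q, funext fun j ↦ ?_⟩
      fin_cases j
      exacts [h0, h1, h2]
    · rintro ⟨q, rfl⟩
      have h := congrArg (q • ·) (cyclic_sum_eq_zero hg0 ho₁ h₂₃ h₃₁ h₁₂)
      simpa [smul_smul] using h
  refine ⟨⟨rfl, _, isMinGenSyz_of_constantCoeff hv hspan ?_ fun r hr j ↦ ?_⟩, ?_⟩
  · simp [Fin.monotone_iff_le_succ, Fin.forall_fin_two]
  · obtain ⟨q, rfl⟩ := (hrel r).1 hr
    fin_cases j <;> simp
  · filter_upwards [Filter.eventually_ge_atTop 20] with k hk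
    obtain ⟨n, rfl⟩ := Nat.exists_eq_add_of_le hk
    have h := milnorDim_add_eq (n := n + 11) (fun i ↦ hhom.pderiv (i := i)) hv hspan (by
      simp [Fin.forall_fin_succ])
    rw [finrank_relationPiece (e := 7) (by simp [Fin.forall_fin_succ]) (by omega) ?_ ?_ hrel,
      Fin.sum_univ_three] at h
    · simp only [Matrix.cons_val] at h
      rw [show n + 11 - 5 = n + 6 by omega, show n + 11 - 6 = n + 5 by omega,
        show n + 11 - 7 = n + 4 by omega, show n + 11 + (10 - 1) = 20 + n by omega] at h
      have h₀ := two_mul_choose_two (n + 12)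
      have h₁ := two_mul_choose_two (n + 7)
      have h₂ := two_mul_choose_two (n + 6)
      have h₃ := two_mul_choose_two (n + 5)
      have h₄ := two_mul_choose_two (20 + n + 1)
      linarith
    · intro j
      fin_cases j
      · exact ((isHomogeneous_C _ _).mul (isHomogeneous_X_pow 0 2)).add
          ((isHomogeneous_C _ _).mul (isHomogeneous_X_pow 2 2))
      · exact (((isHomogeneous_C _ _).mul (isHomogeneous_X _ 0)).mul (isHomogeneous_X _ 2)).sub
          ((isHomogeneous_C _ _).mul (isHomogeneous_X_pow 2 2))
      · exact (((isHomogeneous_C _ _).mul (isHomogeneous_X _ 0)).add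
          ((isHomogeneous_C _ _).mul (isHomogeneous_X _ 1))).sub
          ((isHomogeneous_C _ _).mul (isHomogeneous_X _ 2))
    · exact fun h ↦ hne₃ (congrFun h 2)

theorem isHomogeneous_sub {p q : S3} {n : ℕ} (hp : p.IsHomogeneous n) (hq : q.IsHomogeneous n) :
    (p - q).IsHomogeneous n :=
  hp.sub hq

/-- The monomial `x ^ a * y ^ b * z ^ c`. -/
def xyz (a b c : ℕ) : S3 := X 0 ^ a * X 1 ^ b * X 2 ^ c

theorem isHomogeneous_ofNat_mul_xyz (k : ℕ) [k.AtLeastTwo] {a b c n : ℕ} (h : a + b + c = n) :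
    ((OfNat.ofNat k : S3) * xyz a b c).IsHomogeneous n := by
  subst h
  rw [← map_ofNat (C (σ := Fin 3))]
  exact (((isHomogeneous_X_pow 0 a).mul (isHomogeneous_X_pow 1 b)).mul
    (isHomogeneous_X_pow 2 c)).C_mul _

theorem isHomogeneous_neg_ofNat_mul_xyz (k : ℕ) [k.AtLeastTwo] {a b c n : ℕ}
    (h : a + b + c = n) : (-(OfNat.ofNat k : S3) * xyz a b c).IsHomogeneous n := by
  rw [neg_mul]
  exact (isHomogeneous_ofNat_mul_xyz k h).neg

/-- Nine times the part of `f0` of positive degree in the first two variables, plus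
`t * X 2 ^ 10`. -/
def brianconForm (t : ℂ) : S3 :=
  9 * xyz 6 4 0 + 36 * xyz 5 3 2 + 27 * xyz 4 3 3 + 54 * xyz 4 2 4 + 57 * xyz 3 2 5 +
    36 * xyz 3 1 6 + 27 * xyz 2 2 6 + 33 * xyz 2 1 7 + 9 * xyz 2 0 8 + 18 * xyz 1 1 8 +
    3 * xyz 1 0 9 + 9 * xyz 0 1 9 + C t * xyz 0 0 10

/-- The gradient of `brianconForm t`. -/
def brianconGradient (t : ℂ) : Fin 3 → S3 :=
  ![54 * xyz 5 4 0 + 180 * xyz 4 3 2 + 108 * xyz 3 3 3 + 216 * xyz 3 2 4 + 171 * xyz 2 2 5 +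
      108 * xyz 2 1 6 + 54 * xyz 1 2 6 + 66 * xyz 1 1 7 + 18 * xyz 1 0 8 + 18 * xyz 0 1 8 +
      3 * xyz 0 0 9,
    36 * xyz 6 3 0 + 108 * xyz 5 2 2 + 81 * xyz 4 2 3 + 108 * xyz 4 1 4 + 114 * xyz 3 1 5 +
      36 * xyz 3 0 6 + 54 * xyz 2 1 6 + 33 * xyz 2 0 7 + 18 * xyz 1 0 8 + 9 * xyz 0 0 9,
    72 * xyz 5 3 1 + 81 * xyz 4 3 2 + 216 * xyz 4 2 3 + 285 * xyz 3 2 4 + 216 * xyz 3 1 5 +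
      162 * xyz 2 2 5 + 231 * xyz 2 1 6 + 72 * xyz 2 0 7 + 144 * xyz 1 1 7 + 27 * xyz 1 0 8 +
      81 * xyz 0 1 8 + 10 * C t * xyz 0 0 9]

/-- A syzygy of degree 5 of `f0`. -/
def syz0a : Fin 3 → S3 :=
  ![-634880 * xyz 4 1 0 - 7452 * xyz 3 2 0 + 257280 * xyz 3 1 1 - 634880 * xyz 3 0 2 -
      79452 * xyz 2 1 2 - 218880 * xyz 2 0 3 - 4779 * xyz 1 1 3 + 7872 * xyz 1 0 4 -
      11520 * xyz 0 0 5,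
    952320 * xyz 3 2 0 + 11178 * xyz 2 3 0 - 385920 * xyz 2 2 1 + 1269760 * xyz 2 1 2 +
      124848 * xyz 1 2 2 - 38400 * xyz 1 1 3 + 317440 * xyz 1 0 4 + 6561 * xyz 0 2 3 +
      134982 * xyz 0 1 4 - 128640 * xyz 0 0 5,
    -972 * xyz 2 2 1 - 5292 * xyz 1 1 3 - 729 * xyz 0 1 4 - 13248 * xyz 0 0 5]

/-- A syzygy of degree 5 of `f0`. -/
def syz0b : Fin 3 → S3 :=
  ![-266240 * xyz 4 1 0 + 4140 * xyz 3 2 0 + 70400 * xyz 3 1 1 - 266240 * xyz 3 0 2 +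
      16716 * xyz 2 1 2 - 129280 * xyz 2 0 3 + 2655 * xyz 1 1 3 - 24288 * xyz 1 0 4 -
      960 * xyz 0 0 5,
    399360 * xyz 3 2 0 - 6210 * xyz 2 3 0 - 111360 * xyz 2 2 1 + 532480 * xyz 2 1 2 -
      34704 * xyz 1 2 2 + 47360 * xyz 1 1 3 + 133120 * xyz 1 0 4 - 3645 * xyz 0 2 3 +
      43122 * xyz 0 1 4 - 40960 * xyz 0 0 5,
    2880 * xyz 3 2 0 + 540 * xyz 2 2 1 + 5760 * xyz 2 1 2 + 3996 * xyz 1 1 3 + 2880 * xyz 1 0 4 +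
      405 * xyz 0 1 4 - 4128 * xyz 0 0 5]

/-- A syzygy of degree 6 of `f0`. -/
def syz0c : Fin 3 → S3 :=
  ![20480 * xyz 5 1 0 - 3840 * xyz 4 1 1 + 20480 * xyz 4 0 2 + 828 * xyz 3 1 2 +
      11520 * xyz 3 0 3 + 1596 * xyz 2 0 4 + 531 * xyz 1 0 5,
    -30720 * xyz 4 2 0 + 5760 * xyz 3 2 1 - 40960 * xyz 3 1 2 - 1242 * xyz 2 2 2 -
      7680 * xyz 2 1 3 - 10240 * xyz 2 0 4 - 4464 * xyz 1 1 4 + 1920 * xyz 1 0 5 -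
      729 * xyz 0 1 5 + 810 * xyz 0 0 6,
    108 * xyz 2 1 3 + 396 * xyz 1 0 5 + 81 * xyz 0 0 6]

/-- A syzygy of degree 5 of `f1`. -/
def syz1a : Fin 3 → S3 :=
  ![-2675000 * xyz 4 1 0 - 7452 * xyz 3 2 0 + 739500 * xyz 3 1 1 - 2675000 * xyz 3 0 2 -
      119952 * xyz 2 1 2 - 785250 * xyz 2 0 3 - 4779 * xyz 1 1 3 + 35925 * xyz 1 0 4 -
      18000 * xyz 0 0 5,
    4012500 * xyz 3 2 0 + 11178 * xyz 2 3 0 - 1109250 * xyz 2 2 1 + 5350000 * xyz 2 1 2 +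
      185598 * xyz 1 2 2 - 195000 * xyz 1 1 3 + 1337500 * xyz 1 0 4 + 6561 * xyz 0 2 3 +
      298845 * xyz 0 1 4 - 610500 * xyz 0 0 5,
    -972 * xyz 2 2 1 - 7722 * xyz 1 1 3 - 729 * xyz 0 1 4 - 30825 * xyz 0 0 5]

/-- A syzygy of degree 5 of `f1`. -/
def syz1b : Fin 3 → S3 :=
  ![-250000 * xyz 4 1 0 + 828 * xyz 3 2 0 + 22000 * xyz 3 1 1 - 250000 * xyz 3 0 2 +
      4758 * xyz 2 1 2 - 96500 * xyz 2 0 3 + 531 * xyz 1 1 3 - 14070 * xyz 1 0 4 - 300 * xyz 0 0 5,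
    375000 * xyz 3 2 0 - 1242 * xyz 2 3 0 - 34800 * xyz 2 2 1 + 500000 * xyz 2 1 2 -
      9792 * xyz 1 2 2 + 36400 * xyz 1 1 3 + 125000 * xyz 1 0 4 - 729 * xyz 0 2 3 +
      23550 * xyz 0 1 4 - 47300 * xyz 0 0 5,
    900 * xyz 3 2 0 + 108 * xyz 2 2 1 + 1800 * xyz 2 1 2 + 1188 * xyz 1 1 3 + 900 * xyz 1 0 4 +
      81 * xyz 0 1 4 - 2370 * xyz 0 0 5]

/-- A syzygy of degree 6 of `f1`. -/
def syz1c : Fin 3 → S3 :=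
  ![50000 * xyz 5 1 0 - 6000 * xyz 4 1 1 + 50000 * xyz 4 0 2 + 828 * xyz 3 1 2 +
      22500 * xyz 3 0 3 + 2028 * xyz 2 0 4 + 531 * xyz 1 0 5,
    -75000 * xyz 4 2 0 + 9000 * xyz 3 2 1 - 100000 * xyz 3 1 2 - 1242 * xyz 2 2 2 -
      12000 * xyz 2 1 3 - 25000 * xyz 2 0 4 - 5922 * xyz 1 1 4 + 7500 * xyz 1 0 5 -
      729 * xyz 0 1 5 + 1620 * xyz 0 0 6,
    108 * xyz 2 1 3 + 558 * xyz 1 0 5 + 81 * xyz 0 0 6]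

/-- A syzygy of degree 4 of `fb`. -/
def syzBa : Fin 3 → S3 :=
  ![92 * xyz 3 1 0 + 92 * xyz 2 0 2 + 59 * xyz 1 0 3,
    -138 * xyz 2 2 0 - 208 * xyz 1 1 2 - 81 * xyz 0 1 3 - 70 * xyz 0 0 4,
    12 * xyz 2 1 1 + 12 * xyz 1 0 3 + 9 * xyz 0 0 4]

/-- A syzygy of degree 5 of `fb`. -/
def syzBb : Fin 3 → S3 :=
  ![-4232 * xyz 4 1 0 - 3036 * xyz 3 1 1 - 4232 * xyz 3 0 2 - 7713 * xyz 2 1 2 - 5750 * xyz 2 0 3 -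
      1380 * xyz 1 0 4 - 2070 * xyz 0 0 5,
    6348 * xyz 3 2 0 + 2934 * xyz 2 2 1 + 9568 * xyz 2 1 2 + 9747 * xyz 1 2 2 + 7350 * xyz 1 1 3 +
      3220 * xyz 1 0 4 + 4140 * xyz 0 1 4 + 690 * xyz 0 0 5,
    810 * xyz 3 2 0 - 552 * xyz 3 1 1 + 1224 * xyz 2 1 2 - 552 * xyz 2 0 3 + 297 * xyz 1 1 3]

theorem brianconForm_isHomogeneous (t : ℂ) : (brianconForm t).IsHomogeneous 10 := by
  have ht : (C t * xyz 0 0 10).IsHomogeneous 10 :=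
    (((isHomogeneous_X_pow 0 0).mul (isHomogeneous_X_pow 1 0)).mul
      (isHomogeneous_X_pow 2 10)).C_mul t
  unfold brianconForm
  repeat' with_reducible first
    | exact ht
    | apply IsHomogeneous.add
    | apply isHomogeneous_ofNat_mul_xyz
  all_goals rfl

theorem pderiv_ofNat (i : Fin 3) (k : ℕ) [k.AtLeastTwo] :
    pderiv i (ofNat(k) : S3) = 0 := by
  rw [← map_ofNat (C (σ := Fin 3)), pderiv_C]

theorem pderiv_brianconForm (t : ℂ) (i : Fin 3) :
    pderiv i (brianconForm t) = brianconGradient t i := by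
  fin_cases i <;>
  · simp [brianconForm, brianconGradient, xyz, pderiv_X, pderiv_ofNat, Derivation.leibniz_pow]
    ring

theorem nine_mul_f0 : 9 * f0 = brianconForm (-9) := by
  have h₁ : (9 * C (19 / 3) : S3) = 57 := by
    rw [← map_ofNat (C (σ := Fin 3)), ← map_ofNat (C (σ := Fin 3)), ← C_mul]
    norm_num
  have h₂ : (9 * C (11 / 3) : S3) = 33 := by
    rw [← map_ofNat (C (σ := Fin 3)), ← map_ofNat (C (σ := Fin 3)), ← C_mul]
    norm_num
  have h₃ : (9 * C (1 / 3) : S3) = 3 := by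
    rw [← map_ofNat (C (σ := Fin 3)), ← map_ofNat (C (σ := Fin 3)), ← C_mul]
    norm_num
  simp only [f0, brianconForm, xyz, map_neg, map_ofNat]
  linear_combination X 0 ^ 3 * X 1 ^ 2 * X 2 ^ 5 * h₁ + X 0 ^ 2 * X 1 * X 2 ^ 7 * h₂ +
    X 0 * X 2 ^ 9 * h₃

theorem nine_mul_f1 : 9 * f1 = brianconForm (-18) := by
  have h := nine_mul_f0
  simp only [f1, brianconForm, xyz, map_neg, map_ofNat] at h ⊢
  linear_combination h

theorem nine_mul_fb : 9 * fb = brianconForm 7 := by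
  have h := nine_mul_f0
  have h₁ : (9 * C (16 / 9) : S3) = 16 := by
    rw [← map_ofNat (C (σ := Fin 3)), ← map_ofNat (C (σ := Fin 3)), ← C_mul]
    norm_num
  simp only [fb, brianconForm, xyz, map_neg, map_ofNat] at h ⊢
  linear_combination h + X 2 ^ 10 * h₁

theorem eq_of_nine_mul_eq {t : ℂ} (h : 9 * f = brianconForm t) : f = C 9⁻¹ * brianconForm t := by
  rw [← h, ← map_ofNat (C (σ := Fin 3)), ← mul_assoc, ← C_mul]
  norm_num

theorem isHomogeneous_of_nine_mul_eq {t : ℂ} (h : 9 * f = brianconForm t) :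
    f.IsHomogeneous 10 := by
  rw [eq_of_nine_mul_eq h]
  exact (brianconForm_isHomogeneous t).C_mul _

theorem pderiv_of_nine_mul_eq {t : ℂ} (h : 9 * f = brianconForm t) (i : Fin 3) :
    pderiv i f = C 9⁻¹ * brianconGradient t i := by
  rw [eq_of_nine_mul_eq h, pderiv_C_mul, pderiv_brianconForm]

theorem eval_gradient_zero (t : ℂ) : eval ![1, 1, 0] (brianconGradient t 0) ≠ 0 := by
  simp [brianconGradient, xyz]

theorem gradient_zero_ne_zero (t : ℂ) : brianconGradient t 0 ≠ 0 := fun h ↦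
  eval_gradient_zero t (by rw [h, map_zero])

theorem isRelPrime_gradient (t : ℂ) :
    IsRelPrime (brianconGradient t 0) (brianconGradient t 1) := by
  refine isRelPrime_of_dvd_pow (n := 14) (X_prime (i := 2)) (fun r h₁ h₂ ↦ ?_)
    (not_X_dvd_of_eval_ne_zero (by simp) (eval_gradient_zero t))
  have h9 : IsUnit (9 : S3) := by
    rw [← map_ofNat (C (σ := Fin 3))]
    exact (isUnit_iff_ne_zero.2 (by norm_num)).map C
  refine h9.dvd_mul_left.1 ?_
  obtain ⟨p, hp⟩ := h₁
  obtain ⟨q, hq⟩ := h₂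
  refine ⟨(4 * xyz 4 1 0 + 4 * xyz 3 0 2 + xyz 2 0 3) * p -
    (6 * xyz 3 2 0 + 8 * xyz 2 1 2 + 2 * xyz 1 0 4 - xyz 0 0 5) * q, ?_⟩
  simp only [brianconGradient, xyz, Matrix.cons_val] at hp hq ⊢
  linear_combination
    (4 * X 0 ^ 4 * X 1 + 4 * X 0 ^ 3 * X 2 ^ 2 + X 0 ^ 2 * X 2 ^ 3) * hp -
    (6 * X 0 ^ 3 * X 1 ^ 2 + 8 * X 0 ^ 2 * X 1 * X 2 ^ 2 + 2 * X 0 * X 2 ^ 4 - X 2 ^ 5) * hq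

theorem syz0a_isHomogeneous (i : Fin 3) : (syz0a i).IsHomogeneous 5 := by
  fin_cases i <;>
  · simp only [syz0a, Fin.zero_eta, Fin.mk_one, Fin.reduceFinMk, Matrix.cons_val]
    repeat' with_reducible first
      | apply IsHomogeneous.add
      | apply isHomogeneous_sub
      | apply isHomogeneous_ofNat_mul_xyz
      | apply isHomogeneous_neg_ofNat_mul_xyz
    all_goals rfl

theorem syz0b_isHomogeneous (i : Fin 3) : (syz0b i).IsHomogeneous 5 := by
  fin_cases i <;>
  · simp only [syz0b, Fin.zero_eta, Fin.mk_one, Fin.reduceFinMk, Matrix.cons_val]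
    repeat' with_reducible first
      | apply IsHomogeneous.add
      | apply isHomogeneous_sub
      | apply isHomogeneous_ofNat_mul_xyz
      | apply isHomogeneous_neg_ofNat_mul_xyz
    all_goals rfl

theorem syz0c_isHomogeneous (i : Fin 3) : (syz0c i).IsHomogeneous 6 := by
  fin_cases i <;>
  · simp only [syz0c, Fin.zero_eta, Fin.mk_one, Fin.reduceFinMk, Matrix.cons_val]
    repeat' with_reducible first
      | apply IsHomogeneous.add
      | apply isHomogeneous_sub
      | apply isHomogeneous_ofNat_mul_xyz
      | apply isHomogeneous_neg_ofNat_mul_xyz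
    all_goals rfl

theorem syz1a_isHomogeneous (i : Fin 3) : (syz1a i).IsHomogeneous 5 := by
  fin_cases i <;>
  · simp only [syz1a, Fin.zero_eta, Fin.mk_one, Fin.reduceFinMk, Matrix.cons_val]
    repeat' with_reducible first
      | apply IsHomogeneous.add
      | apply isHomogeneous_sub
      | apply isHomogeneous_ofNat_mul_xyz
      | apply isHomogeneous_neg_ofNat_mul_xyz
    all_goals rfl

theorem syz1b_isHomogeneous (i : Fin 3) : (syz1b i).IsHomogeneous 5 := by
  fin_cases i <;>
  · simp only [syz1b, Fin.zero_eta, Fin.mk_one, Fin.reduceFinMk, Matrix.cons_val]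
    repeat' with_reducible first
      | apply IsHomogeneous.add
      | apply isHomogeneous_sub
      | apply isHomogeneous_ofNat_mul_xyz
      | apply isHomogeneous_neg_ofNat_mul_xyz
    all_goals rfl

theorem syz1c_isHomogeneous (i : Fin 3) : (syz1c i).IsHomogeneous 6 := by
  fin_cases i <;>
  · simp only [syz1c, Fin.zero_eta, Fin.mk_one, Fin.reduceFinMk, Matrix.cons_val]
    repeat' with_reducible first
      | apply IsHomogeneous.add
      | apply isHomogeneous_sub
      | apply isHomogeneous_ofNat_mul_xyz
      | apply isHomogeneous_neg_ofNat_mul_xyz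
    all_goals rfl

theorem syzBa_isHomogeneous (i : Fin 3) : (syzBa i).IsHomogeneous 4 := by
  fin_cases i <;>
  · simp only [syzBa, Fin.zero_eta, Fin.mk_one, Fin.reduceFinMk, Matrix.cons_val]
    repeat' with_reducible first
      | apply IsHomogeneous.add
      | apply isHomogeneous_sub
      | apply isHomogeneous_ofNat_mul_xyz
      | apply isHomogeneous_neg_ofNat_mul_xyz
    all_goals rfl

theorem syzBb_isHomogeneous (i : Fin 3) : (syzBb i).IsHomogeneous 5 := by
  fin_cases i <;>
  · simp only [syzBb, Fin.zero_eta, Fin.mk_one, Fin.reduceFinMk, Matrix.cons_val]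
    repeat' with_reducible first
      | apply IsHomogeneous.add
      | apply isHomogeneous_sub
      | apply isHomogeneous_ofNat_mul_xyz
      | apply isHomogeneous_neg_ofNat_mul_xyz
    all_goals rfl

theorem syz0a_dotProduct_gradient : syz0a ⬝ᵥ brianconGradient (-9) = 0 := by
  simp only [Matrix.vec3_dotProduct, syz0a, brianconGradient, xyz, map_neg, map_ofNat,
    Matrix.cons_val]
  ring

theorem syz0b_dotProduct_gradient : syz0b ⬝ᵥ brianconGradient (-9) = 0 := by
  simp only [Matrix.vec3_dotProduct, syz0b, brianconGradient, xyz, map_neg, map_ofNat,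
    Matrix.cons_val]
  ring

theorem syz0c_dotProduct_gradient : syz0c ⬝ᵥ brianconGradient (-9) = 0 := by
  simp only [Matrix.vec3_dotProduct, syz0c, brianconGradient, xyz, map_neg, map_ofNat,
    Matrix.cons_val]
  ring

theorem syz1a_dotProduct_gradient : syz1a ⬝ᵥ brianconGradient (-18) = 0 := by
  simp only [Matrix.vec3_dotProduct, syz1a, brianconGradient, xyz, map_neg, map_ofNat,
    Matrix.cons_val]
  ring

theorem syz1b_dotProduct_gradient : syz1b ⬝ᵥ brianconGradient (-18) = 0 := by
  simp only [Matrix.vec3_dotProduct, syz1b, brianconGradient, xyz, map_neg, map_ofNat,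
    Matrix.cons_val]
  ring

theorem syz1c_dotProduct_gradient : syz1c ⬝ᵥ brianconGradient (-18) = 0 := by
  simp only [Matrix.vec3_dotProduct, syz1c, brianconGradient, xyz, map_neg, map_ofNat,
    Matrix.cons_val]
  ring

theorem syzBa_dotProduct_gradient : syzBa ⬝ᵥ brianconGradient 7 = 0 := by
  simp only [Matrix.vec3_dotProduct, syzBa, brianconGradient, xyz, map_ofNat, Matrix.cons_val]
  ring

theorem syzBb_dotProduct_gradient : syzBb ⬝ᵥ brianconGradient 7 = 0 := by
  simp only [Matrix.vec3_dotProduct, syzBb, brianconGradient, xyz, map_ofNat, Matrix.cons_val]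
  ring

theorem cross_syz0b_syz0c : crossProduct syz0b syz0c =
    (C 1638400 * X 0 ^ 2 + C 8640 * X 2 ^ 2 : S3) • brianconGradient (-9) := by
  rw [cross_apply]
  ext1 i
  fin_cases i <;>
  · simp only [syz0b, syz0c, brianconGradient, xyz, map_neg, map_ofNat, Fin.zero_eta, Fin.mk_one,
      Fin.reduceFinMk, Matrix.cons_val, Pi.smul_apply, smul_eq_mul]
    ring

theorem cross_syz0c_syz0a : crossProduct syz0c syz0a =
    (C 552960 * X 0 * X 2 - C 103680 * X 2 ^ 2 : S3) • brianconGradient (-9) := by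
  rw [cross_apply]
  ext1 i
  fin_cases i <;>
  · simp only [syz0c, syz0a, brianconGradient, xyz, map_neg, map_ofNat, Fin.zero_eta, Fin.mk_one,
      Fin.reduceFinMk, Matrix.cons_val, Pi.smul_apply, smul_eq_mul]
    ring

theorem cross_syz0a_syz0b : crossProduct syz0a syz0b =
    (C 50790400 * X 0 + C 596160 * X 1 - C 3870720 * X 2 : S3) • brianconGradient (-9) := by
  rw [cross_apply]
  ext1 i
  fin_cases i <;>
  · simp only [syz0a, syz0b, brianconGradient, xyz, map_neg, map_ofNat, Fin.zero_eta, Fin.mk_one,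
      Fin.reduceFinMk, Matrix.cons_val, Pi.smul_apply, smul_eq_mul]
    ring

theorem cross_syz1b_syz1c : crossProduct syz1b syz1c =
    (C 1250000 * X 0 ^ 2 + C 2700 * X 2 ^ 2 : S3) • brianconGradient (-18) := by
  rw [cross_apply]
  ext1 i
  fin_cases i <;>
  · simp only [syz1b, syz1c, brianconGradient, xyz, map_neg, map_ofNat, Fin.zero_eta, Fin.mk_one,
      Fin.reduceFinMk, Matrix.cons_val, Pi.smul_apply, smul_eq_mul]
    ring

theorem cross_syz1c_syz1a : crossProduct syz1c syz1a =
    (C 1350000 * X 0 * X 2 - C 162000 * X 2 ^ 2 : S3) • brianconGradient (-18) := by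
  rw [cross_apply]
  ext1 i
  fin_cases i <;>
  · simp only [syz1c, syz1a, brianconGradient, xyz, map_neg, map_ofNat, Fin.zero_eta, Fin.mk_one,
      Fin.reduceFinMk, Matrix.cons_val, Pi.smul_apply, smul_eq_mul]
    ring

theorem cross_syz1a_syz1b : crossProduct syz1a syz1b =
    (C 66875000 * X 0 + C 186300 * X 1 - C 3712500 * X 2 : S3) • brianconGradient (-18) := by
  rw [cross_apply]
  ext1 i
  fin_cases i <;>
  · simp only [syz1a, syz1b, brianconGradient, xyz, map_neg, map_ofNat, Fin.zero_eta, Fin.mk_one,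
      Fin.reduceFinMk, Matrix.cons_val, Pi.smul_apply, smul_eq_mul]
    ring

theorem cross_syzBa_syzBb : crossProduct syzBa syzBb =
    (C (-2070) : S3) • brianconGradient 7 := by
  rw [cross_apply]
  ext1 i
  fin_cases i <;>
  · simp only [syzBa, syzBb, brianconGradient, xyz, map_neg, map_ofNat, Fin.zero_eta, Fin.mk_one,
      Fin.reduceFinMk, Matrix.cons_val, Pi.smul_apply, smul_eq_mul]
    ring

end Curves

/-- The degree 10 curves `C₀ : f₀ = 0` and `C₁ : f₁ = 0` are MPOG-curves with exponents
`(5,5,6)` and `τ = 59`, and `C_b : f_b = 0` is free with exponents `(4,5)` and `τ = 61`. -/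
theorem statement7 :
    (IsMPOGWith f0 10 5 5 ∧ IsTjurina f0 59) ∧
    (IsMPOGWith f1 10 5 5 ∧ IsTjurina f1 59) ∧
    (IsFreeWith fb 4 5 ∧ IsTjurina fb 61) := by
  refine ⟨?_, ?_, ?_⟩
  · exact isMPOGWith_and_isTjurina (isHomogeneous_of_nine_mul_eq nine_mul_f0)
      (pderiv_of_nine_mul_eq nine_mul_f0) (isRelPrime_gradient _) (gradient_zero_ne_zero _)
      syz0a_isHomogeneous syz0b_isHomogeneous syz0c_isHomogeneous
      syz0a_dotProduct_gradient syz0b_dotProduct_gradient syz0c_dotProduct_gradient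
      (by norm_num) (by norm_num) (by norm_num)
      cross_syz0b_syz0c cross_syz0c_syz0a cross_syz0a_syz0b
  · exact isMPOGWith_and_isTjurina (isHomogeneous_of_nine_mul_eq nine_mul_f1)
      (pderiv_of_nine_mul_eq nine_mul_f1) (isRelPrime_gradient _) (gradient_zero_ne_zero _)
      syz1a_isHomogeneous syz1b_isHomogeneous syz1c_isHomogeneous
      syz1a_dotProduct_gradient syz1b_dotProduct_gradient syz1c_dotProduct_gradient
      (by norm_num) (by norm_num) (by norm_num)
      cross_syz1b_syz1c cross_syz1c_syz1a cross_syz1a_syz1b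
  · exact isFreeWith_and_isTjurina (isHomogeneous_of_nine_mul_eq nine_mul_fb)
      (pderiv_of_nine_mul_eq nine_mul_fb) (isRelPrime_gradient _) (gradient_zero_ne_zero _)
      syzBa_isHomogeneous syzBb_isHomogeneous syzBa_dotProduct_gradient
      syzBb_dotProduct_gradient (by norm_num) cross_syzBa_syzBb

end
end
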